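/- arXiv:1711.09741 — 2 statements merged into one kernel-verified Lean document; each statement's English description precedes it below -/
import Mathlib

section
/- Let p = p(n) satisfy p·n → ∞ and p ≤ 1, and let H ~ H₃(n;p). Then for every γ > 0, with probability tending to 1 as n → ∞, the triangle set of H contains a set S of edge-disjoint triangles such that every vertex v satisfies d_S(v) ≥ (1−γ)n. -/
attribute [local instance] Classical.propDecidable

noncomputable section

/-- The number of ones in an `m × n × k` 0-1 array. -/
def numOnes {m n k : ℕ} (M : Fin m → Fin n → Fin k → Bool) : ℕ :=
  (Finset.univ.filter (fun x : Fin m × Fin n × Fin k => M x.1 x.2.1 x.2.2 = true)).card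

/-- An `m × n × k` 0-1 array is a Latin box if it has exactly `m * n` ones and
every line (fixing two coordinates, varying the third) has at most one `1`. -/
def IsLatinBox {m n k : ℕ} (M : Fin m → Fin n → Fin k → Bool) : Prop :=
  numOnes M = m * n ∧
  (∀ i j, (Finset.univ.filter (fun c => M i j c = true)).card ≤ 1) ∧
  (∀ i c, (Finset.univ.filter (fun j => M i j c = true)).card ≤ 1) ∧
  (∀ j c, (Finset.univ.filter (fun i => M i j c = true)).card ≤ 1)

/-- `M` contains (supports) a Latin box. -/
def ContainsLatinBox {m n k : ℕ} (M : Fin m → Fin n → Fin k → Bool) : Prop :=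
  ∃ L : Fin m → Fin n → Fin k → Bool, IsLatinBox L ∧ ∀ i j c, L i j c = true → M i j c = true

/-- The probability that a random `m × n × k` 0-1 array, whose entries are
independently `1` with probability `p`, satisfies the property `P`. -/
def arrProb (m n k : ℕ) (p : ℝ) (P : (Fin m → Fin n → Fin k → Bool) → Prop) : ℝ :=
  ∑ M : Fin m → Fin n → Fin k → Bool,
    if P M then ∏ i, ∏ j, ∏ c, (if M i j c = true then p else 1 - p) else 0

/-- A set of triangles (of the tripartite `3`-uniform hypergraph on `[n]⊔[n]⊔[n]`) is
edge-disjoint if no two distinct triangles agree in two or more coordinates. -/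
def EdgeDisjointSet {n : ℕ} (S : Finset (Fin n × Fin n × Fin n)) : Prop :=
  ∀ t ∈ S, ∀ t' ∈ S, t ≠ t' →
    ¬(t.1 = t'.1 ∧ t.2.1 = t'.2.1) ∧ ¬(t.1 = t'.1 ∧ t.2.2 = t'.2.2) ∧
    ¬(t.2.1 = t'.2.1 ∧ t.2.2 = t'.2.2)

section weightProb

/-- The probability of the event `P` under the weight function `μ` on a finite type. -/
def weightProb {Ω : Type*} [Fintype Ω] (μ : Ω → ℝ) (P : Ω → Prop) : ℝ :=
  ∑ x, if P x then μ x else 0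

/-- The weight of a random `n × n` 0-1 matrix with independent Bernoulli entries. -/
def matWeight {n : ℕ} (p : ℝ) (x : Fin n → Fin n → Bool) : ℝ :=
  ∏ j, ∏ c, (if x j c = true then p else 1 - p)

variable {Ω : Type*} [Fintype Ω] {μ : Ω → ℝ}

lemma weightProb_mono (hμ : ∀ x, 0 ≤ μ x) {P Q : Ω → Prop} (h : ∀ x, P x → Q x) :
    weightProb μ P ≤ weightProb μ Q := by
  refine Finset.sum_le_sum fun x _ => ?_
  by_cases hP : P x
  · simp [hP, h x hP]
  · rw [if_neg hP]
    split_ifs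
    exacts [hμ x, le_rfl]

lemma weightProb_nonneg (hμ : ∀ x, 0 ≤ μ x) (P : Ω → Prop) : 0 ≤ weightProb μ P := by
  refine Finset.sum_nonneg fun x _ => ?_
  split_ifs
  exacts [hμ x, le_rfl]

lemma weightProb_exists_le (hμ : ∀ x, 0 ≤ μ x) {α : Type*} (s : Finset α) (P : α → Ω → Prop) :
    weightProb μ (fun x => ∃ a ∈ s, P a x) ≤ ∑ a ∈ s, weightProb μ (P a) := by
  unfold weightProb
  rw [Finset.sum_comm]
  refine Finset.sum_le_sum fun x _ => ?_
  have h0 : ∀ a ∈ s, 0 ≤ if P a x then μ x else 0 := fun a _ => by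
    split_ifs
    exacts [hμ x, le_rfl]
  by_cases h : ∃ a ∈ s, P a x
  · rw [if_pos h]
    obtain ⟨a, ha, hP⟩ := h
    calc μ x = if P a x then μ x else 0 := by rw [if_pos hP]
      _ ≤ _ := Finset.single_le_sum h0 ha
  · rw [if_neg h]
    exact Finset.sum_nonneg h0

lemma weightProb_or_le (hμ : ∀ x, 0 ≤ μ x) (P Q : Ω → Prop) :
    weightProb μ (fun x => P x ∨ Q x) ≤ weightProb μ P + weightProb μ Q := by
  unfold weightProb
  rw [← Finset.sum_add_distrib]
  refine Finset.sum_le_sum fun x _ => ?_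
  have := hμ x
  by_cases hP : P x <;> by_cases hQ : Q x <;> simp [hP, hQ, this]

lemma weightProb_not (h1 : ∑ x, μ x = 1) (P : Ω → Prop) :
    weightProb μ (fun x => ¬ P x) = 1 - weightProb μ P := by
  unfold weightProb
  rw [← h1, eq_sub_iff_add_eq, ← Finset.sum_add_distrib]
  refine Finset.sum_congr rfl fun x _ => ?_
  by_cases hP : P x <;> simp [hP]

/-- Resampling one coordinate of a product measure: if, whatever the other coordinates are,
the event has probability at most `q` over the coordinate `i`, then it has probability at
most `q`. -/
lemma weightProb_pi_le {ι : Type*} [Fintype ι] [DecidableEq ι] (hμ : ∀ x, 0 ≤ μ x)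
    (h1 : ∑ x, μ x = 1)
    (i : ι) (P : (ι → Ω) → Prop) (q : ℝ)
    (hq : ∀ M : ι → Ω, weightProb μ (fun x => P (Function.update M i x)) ≤ q) :
    weightProb (fun M : ι → Ω => ∏ k, μ (M k)) P ≤ q := by
  have hΩ : Nonempty Ω := by
    by_contra h
    rw [not_nonempty_iff] at h
    simp at h1
  obtain ⟨x₀⟩ := hΩ
  let e := Equiv.funSplitAt i Ω
  have hupd : ∀ (x : Ω) (r : {k // k ≠ i} → Ω),
      e.symm (x, r) = Function.update (e.symm (x₀, r)) i x := by
    intro x r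
    ext k
    by_cases hk : k = i
    · subst hk; simp [e]
    · simp [e, hk]
  have hprod : ∀ (x : Ω) (r : {k // k ≠ i} → Ω),
      ∏ k, μ (e.symm (x, r) k) = μ x * ∏ k, μ (r k) := by
    intro x r
    rw [Fintype.prod_eq_mul_prod_subtype_ne _ i]
    congr 1
    · rw [hupd, Function.update_self]
    · refine Finset.prod_congr rfl fun k _ => ?_
      simp [e, k.2]
  have hrest : ∑ r : {k // k ≠ i} → Ω, ∏ k, μ (r k) = 1 := by
    rw [← Fintype.prod_sum (fun _ x => μ x)]
    simp [h1]
  unfold weightProb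
  rw [← e.symm.sum_comp, Fintype.sum_prod_type_right]
  calc _ = ∑ r : {k // k ≠ i} → Ω, (∏ k, μ (r k)) *
        weightProb μ (fun x => P (Function.update (e.symm (x₀, r)) i x)) := by
        refine Finset.sum_congr rfl fun r _ => ?_
        unfold weightProb
        rw [Finset.mul_sum]
        refine Finset.sum_congr rfl fun x _ => ?_
        simp only [hprod, ← hupd, mul_ite, mul_zero]
        rw [mul_comm]
    _ ≤ ∑ r : {k // k ≠ i} → Ω, (∏ k, μ (r k)) * q := by
        refine Finset.sum_le_sum fun r _ => ?_
        exact mul_le_mul_of_nonneg_left (hq _) (Finset.prod_nonneg fun k _ => hμ _)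
    _ = q := by rw [← Finset.sum_mul, hrest, one_mul]

end weightProb

section matWeight

variable {n : ℕ} {p : ℝ}

lemma matWeight_nonneg (hp0 : 0 ≤ p) (hp1 : p ≤ 1) (x : Fin n → Fin n → Bool) :
    0 ≤ matWeight p x := by
  refine Finset.prod_nonneg fun j _ => Finset.prod_nonneg fun c _ => ?_
  split_ifs <;> linarith

lemma sum_prod_prod (f : Fin n → Fin n → Bool → ℝ) :
    ∑ x : Fin n → Fin n → Bool, ∏ j, ∏ c, f j c (x j c) = ∏ j, ∏ c, ∑ b, f j c b := by
  simp_rw [Fintype.prod_sum]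

lemma sum_matWeight : ∑ x : Fin n → Fin n → Bool, matWeight p x = 1 := by
  unfold matWeight
  rw [sum_prod_prod (fun _ _ b => if b = true then p else 1 - p)]
  simp

lemma weightProb_avoid_le (hp0 : 0 ≤ p) (hp1 : p ≤ 1) (E : Finset (Fin n × Fin n)) :
    weightProb (matWeight p) (fun x => ∀ e ∈ E, x e.1 e.2 = false) ≤
      Real.exp (-(p * E.card)) := by
  have key : weightProb (matWeight p) (fun x => ∀ e ∈ E, x e.1 e.2 = false) ≤
      ∑ x : Fin n → Fin n → Bool, ∏ j, ∏ c,
        (if (j, c) ∈ E then (if x j c = true then 0 else 1 - p)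
          else (if x j c = true then p else 1 - p)) := by
    refine Finset.sum_le_sum fun x _ => ?_
    split_ifs with h
    · refine le_of_eq ?_
      refine Finset.prod_congr rfl fun j _ => Finset.prod_congr rfl fun c _ => ?_
      by_cases hjc : (j, c) ∈ E
      · simp [hjc, h _ hjc]
      · simp [hjc]
    · refine Finset.prod_nonneg fun j _ => Finset.prod_nonneg fun c _ => ?_
      split_ifs <;> linarith
  refine key.trans ?_
  rw [sum_prod_prod (fun j c b => if (j, c) ∈ E then (if b = true then 0 else 1 - p)
          else (if b = true then p else 1 - p))]
  rw [← Fintype.prod_prod_type' (fun j c => ∑ b, if (j, c) ∈ E then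
    (if b = true then 0 else 1 - p) else (if b = true then p else 1 - p))]
  have : ∀ e : Fin n × Fin n, (∑ b, if (e.1, e.2) ∈ E then
      (if b = true then 0 else 1 - p) else (if b = true then p else 1 - p)) =
      if e ∈ E then 1 - p else 1 := by
    intro e
    by_cases he : e ∈ E <;> simp [he]
  simp_rw [this]
  rw [Finset.prod_ite]
  simp only [Finset.prod_const, Finset.filter_univ_mem, one_pow, mul_one]
  calc (1 - p) ^ E.card ≤ (Real.exp (-p)) ^ E.card := by
        refine pow_le_pow_left₀ (by linarith) ?_ _
        have := Real.add_one_le_exp (-p)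
        linarith
    _ = _ := by
        rw [← Real.exp_nat_mul, mul_neg, mul_comm]

/-- With high probability a random subset of `G` meets all dense boxes of `G`. -/
lemma weightProb_empty_box_le (hp0 : 0 ≤ p) (hp1 : p ≤ 1) (G : Finset (Fin n × Fin n)) (c : ℝ) :
    weightProb (matWeight p) (fun x => ∃ A B : Finset (Fin n),
      c ≤ (((A ×ˢ B) ∩ G).card : ℝ) ∧ ∀ e ∈ (A ×ˢ B) ∩ G, x e.1 e.2 = false) ≤
      4 ^ n * Real.exp (-(p * c)) := by
  have hw := matWeight_nonneg (n := n) hp0 hp1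
  calc _ ≤ weightProb (matWeight p) (fun x =>
        ∃ AB ∈ (Finset.univ : Finset (Finset (Fin n) × Finset (Fin n))),
        c ≤ (((AB.1 ×ˢ AB.2) ∩ G).card : ℝ) ∧
          ∀ e ∈ (AB.1 ×ˢ AB.2) ∩ G, x e.1 e.2 = false) := by
        refine weightProb_mono hw ?_
        rintro x ⟨A, B, h⟩
        exact ⟨(A, B), Finset.mem_univ _, h⟩
    _ ≤ _ := weightProb_exists_le hw _ _
    _ ≤ ∑ AB : Finset (Fin n) × Finset (Fin n), Real.exp (-(p * c)) := by
        refine Finset.sum_le_sum fun AB _ => ?_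
        by_cases hc : c ≤ (((AB.1 ×ˢ AB.2) ∩ G).card : ℝ)
        · simp only [hc, true_and]
          refine (weightProb_avoid_le hp0 hp1 _).trans ?_
          gcongr
        · simp only [hc, false_and]
          simp [weightProb, Real.exp_nonneg]
    _ = _ := by
        simp only [Finset.sum_const, Finset.card_univ, Fintype.card_prod, Fintype.card_finset,
          Fintype.card_fin, nsmul_eq_mul, Nat.cast_mul, Nat.cast_pow, Nat.cast_ofNat]
        rw [← mul_pow]
        norm_num

end matWeight

lemma EdgeDisjointSet.eq_of_fst_of_snd {n : ℕ} {S : Finset (Fin n × Fin n × Fin n)}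
    (hS : EdgeDisjointSet S) {t t' : Fin n × Fin n × Fin n} (ht : t ∈ S) (ht' : t' ∈ S)
    (h1 : t.1 = t'.1) (h2 : t.2.1 = t'.2.1) : t = t' := by
  by_contra hne
  exact (hS t ht t' ht' hne).1 ⟨h1, h2⟩

lemma EdgeDisjointSet.eq_of_fst_of_trd {n : ℕ} {S : Finset (Fin n × Fin n × Fin n)}
    (hS : EdgeDisjointSet S) {t t' : Fin n × Fin n × Fin n} (ht : t ∈ S) (ht' : t' ∈ S)
    (h1 : t.1 = t'.1) (h2 : t.2.2 = t'.2.2) : t = t' := by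
  by_contra hne
  exact (hS t ht t' ht' hne).2.1 ⟨h1, h2⟩

lemma EdgeDisjointSet.eq_of_snd_of_trd {n : ℕ} {S : Finset (Fin n × Fin n × Fin n)}
    (hS : EdgeDisjointSet S) {t t' : Fin n × Fin n × Fin n} (ht : t ∈ S) (ht' : t' ∈ S)
    (h1 : t.2.1 = t'.2.1) (h2 : t.2.2 = t'.2.2) : t = t' := by
  by_contra hne
  exact (hS t ht t' ht' hne).2.2 ⟨h1, h2⟩

/-- A deficiency version of Hall's theorem. -/
lemma exists_matching_of_hall {n : ℕ} (L R : Finset (Fin n)) (adj : Fin n → Fin n → Prop) (D : ℕ)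
    (h : ∀ A ⊆ L, A.card ≤ (R.filter (fun k => ∃ j ∈ A, adj j k)).card + D) :
    ∃ M : Finset (Fin n × Fin n), (∀ e ∈ M, e.1 ∈ L ∧ e.2 ∈ R ∧ adj e.1 e.2) ∧
      (∀ e ∈ M, ∀ e' ∈ M, e.1 = e'.1 → e = e') ∧ (∀ e ∈ M, ∀ e' ∈ M, e.2 = e'.2 → e = e') ∧
      L.card ≤ M.card + D := by
  let t : {j // j ∈ L} → Finset (Fin n ⊕ Fin D) := fun j =>
    (R.filter (adj j)).disjSum Finset.univ
  have hall : ∀ s : Finset {j // j ∈ L}, s.card ≤ (s.biUnion t).card := by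
    intro s
    rcases s.eq_empty_or_nonempty with rfl | ⟨j₀, hj₀⟩
    · simp
    have hA := h (s.map (Function.Embedding.subtype _)) (by
      intro j hj
      simp only [Finset.mem_map, Function.Embedding.subtype_apply] at hj
      obtain ⟨a, _, rfl⟩ := hj
      exact a.2)
    rw [Finset.card_map] at hA
    refine hA.trans ?_
    have : ((R.filter (fun k => ∃ j ∈ s.map (Function.Embedding.subtype _), adj j k)).disjSum
        (Finset.univ : Finset (Fin D))).card ≤ (s.biUnion t).card := by
      refine Finset.card_le_card ?_
      intro z hz
      rw [Finset.mem_biUnion]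
      rcases z with k | d
      · simp only [Finset.inl_mem_disjSum, Finset.mem_filter, Finset.mem_map,
          Function.Embedding.subtype_apply] at hz
        obtain ⟨hk, j, ⟨a, ha, rfl⟩, hadj⟩ := hz
        exact ⟨a, ha, by simp [t, hk, hadj]⟩
      · exact ⟨j₀, hj₀, by simp [t]⟩
    simpa [Finset.card_disjSum] using this
  obtain ⟨f, hf, hft⟩ := (Finset.all_card_le_biUnion_card_iff_exists_injective t).1 hall
  let M : Finset (Fin n × Fin n) :=
    Finset.univ.filter (fun e => ∃ hj : e.1 ∈ L, f ⟨e.1, hj⟩ = Sum.inl e.2)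
  have hM : ∀ e, e ∈ M ↔ ∃ hj : e.1 ∈ L, f ⟨e.1, hj⟩ = Sum.inl e.2 := by simp [M]
  refine ⟨M, ?_, ?_, ?_, ?_⟩
  · intro e he
    obtain ⟨hj, he⟩ := (hM e).1 he
    have := hft ⟨e.1, hj⟩
    rw [he] at this
    simp only [t, Finset.inl_mem_disjSum, Finset.mem_filter] at this
    exact ⟨hj, this⟩
  · rintro ⟨j, k⟩ he ⟨j', k'⟩ he' hjj
    obtain ⟨hj, he⟩ := (hM _).1 he
    obtain ⟨hj', he'⟩ := (hM _).1 he'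
    simp only at hjj
    subst hjj
    simp only at he he'
    rw [he] at he'
    simp only [Sum.inl.injEq] at he'
    rw [he']
  · rintro ⟨j, k⟩ he ⟨j', k'⟩ he' hkk
    obtain ⟨hj, he⟩ := (hM _).1 he
    obtain ⟨hj', he'⟩ := (hM _).1 he'
    simp only at hkk
    subst hkk
    simp only at he he'
    have := hf (he.trans he'.symm)
    simp only [Subtype.mk.injEq] at this
    rw [this]
  · have hsub : Finset.univ.image f ⊆ (M.image Prod.snd).disjSum Finset.univ := by
      intro z hz
      simp only [Finset.mem_image, Finset.mem_univ, true_and] at hz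
      obtain ⟨⟨j, hj⟩, rfl⟩ := hz
      rcases hz : f ⟨j, hj⟩ with k | d
      · simp only [Finset.inl_mem_disjSum, Finset.mem_image]
        exact ⟨(j, k), (hM _).2 ⟨hj, hz⟩, rfl⟩
      · simp
    have h1 := Finset.card_le_card hsub
    rw [Finset.card_image_of_injective _ hf, Finset.card_disjSum] at h1
    have h2 : (M.image Prod.snd).card ≤ M.card := Finset.card_image_le
    simp only [Finset.card_univ, Fintype.card_coe, Fintype.card_fin] at h1
    omega

/-- In a box, the pairs not covered by an edge-disjoint set with few missing triangles form an
almost regular bipartite graph. -/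
lemma card_uncovered_ge {n : ℕ} {S : Finset (Fin n × Fin n × Fin n)} (hS : EdgeDisjointSet S)
    {I L R : Finset (Fin n)} (hLR : L.card = R.card)
    (hsup : ∀ t ∈ S, t.1 ∈ I ∧ t.2.1 ∈ L ∧ t.2.2 ∈ R) {A B : Finset (Fin n)} (hA : A ⊆ L)
    (hB : B ⊆ R) {G : Finset (Fin n × Fin n)} (hG : ∀ e, e ∈ G ↔ ∀ i, (i, e) ∉ S) :
    ((L.card : ℝ) - I.card) * (A.card + B.card - L.card) - (L.card * I.card - S.card) ≤
      (((A ×ˢ B) ∩ G).card : ℝ) := by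
  let u : Finset (Fin n) → Finset (Fin n) → ℕ := fun X Y =>
    (S.filter (fun t => t.2.1 ∈ X ∧ t.2.2 ∈ Y)).card
  have hGc : A.card * B.card = ((A ×ˢ B) ∩ G).card + u A B := by
    rw [← Finset.card_product, ← Finset.card_inter_add_card_sdiff (A ×ˢ B) G]
    congr 1
    have : u A B = ((S.filter (fun t => t.2.1 ∈ A ∧ t.2.2 ∈ B)).image Prod.snd).card := by
      rw [Finset.card_image_of_injOn]
      intro t ht t' ht' h
      simp only [Finset.coe_filter, Set.mem_ofPred_eq] at ht ht'
      exact hS.eq_of_snd_of_trd ht.1 ht'.1 (by rw [h]) (by rw [h])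
    rw [this]
    congr 1
    ext ⟨j, k⟩
    simp only [Finset.mem_sdiff, Finset.mem_product, hG, not_forall, not_not, Finset.mem_image,
      Finset.mem_filter]
    constructor
    · rintro ⟨⟨hj, hk⟩, i, hi⟩
      exact ⟨(i, j, k), ⟨hi, hj, hk⟩, rfl⟩
    · rintro ⟨⟨i, j', k'⟩, ⟨hi, hj, hk⟩, h⟩
      simp only [Prod.mk.injEq] at h
      obtain ⟨rfl, rfl⟩ := h
      exact ⟨⟨hj, hk⟩, i, hi⟩
  have h1 : u A R ≤ I.card * A.card := by
    rw [← Finset.card_product]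
    refine Finset.card_le_card_of_injOn (fun t => (t.1, t.2.1)) ?_ ?_
    · intro t ht
      simp only [Finset.coe_filter, Set.mem_ofPred_eq] at ht
      simp [(hsup t ht.1).1, ht.2.1]
    · intro t ht t' ht' h
      simp only [Finset.coe_filter, Set.mem_ofPred_eq, Prod.mk.injEq] at ht ht' h
      exact hS.eq_of_fst_of_snd ht.1 ht'.1 h.1 h.2
  have h2 : u L B ≤ I.card * B.card := by
    rw [← Finset.card_product]
    refine Finset.card_le_card_of_injOn (fun t => (t.1, t.2.2)) ?_ ?_
    · intro t ht
      simp only [Finset.coe_filter, Set.mem_ofPred_eq] at ht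
      simp [(hsup t ht.1).1, ht.2.2]
    · intro t ht t' ht' h
      simp only [Finset.coe_filter, Set.mem_ofPred_eq, Prod.mk.injEq] at ht ht' h
      exact hS.eq_of_fst_of_trd ht.1 ht'.1 h.1 h.2
  have h3 : u (L \ A) (R \ B) ≤ (L \ A).card * (R \ B).card := by
    rw [← Finset.card_product]
    refine Finset.card_le_card_of_injOn Prod.snd ?_ ?_
    · intro t ht
      simp only [Finset.coe_filter, Set.mem_ofPred_eq] at ht
      simpa using ht.2
    · intro t ht t' ht' h
      simp only [Finset.coe_filter, Set.mem_ofPred_eq] at ht ht'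
      exact hS.eq_of_snd_of_trd ht.1 ht'.1 (by rw [h]) (by rw [h])
  have splitR : ∀ X, X ⊆ L → u X R = u X B + u X (R \ B) := by
    intro X _
    simp only [u]
    rw [← Finset.card_filter_add_card_filter_not (s := S.filter (fun t => t.2.1 ∈ X ∧ t.2.2 ∈ R))
      (fun t => t.2.2 ∈ B)]
    simp only [Finset.filter_filter]
    congr 2
    · ext t
      simp only [Finset.mem_filter]
      have := @hB t.2.2
      tauto
    · ext t
      simp only [Finset.mem_filter, Finset.mem_sdiff]
      tauto
  have splitL : u L (R \ B) = u A (R \ B) + u (L \ A) (R \ B) := by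
    simp only [u]
    rw [← Finset.card_filter_add_card_filter_not
      (s := S.filter (fun t => t.2.1 ∈ L ∧ t.2.2 ∈ R \ B)) (fun t => t.2.1 ∈ A)]
    simp only [Finset.filter_filter]
    congr 2
    · ext t
      simp only [Finset.mem_filter]
      have := @hA t.2.1
      tauto
    · ext t
      simp only [Finset.mem_filter, Finset.mem_sdiff]
      tauto
  have htot : u L R = S.card := by
    simp only [u]
    rw [Finset.filter_true_of_mem fun t ht => (hsup t ht).2]
  have s1 := splitR A hA
  have s2 := splitR L subset_rfl
  have c1 := Finset.card_sdiff_add_card_eq_card hA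
  have c2 := Finset.card_sdiff_add_card_eq_card hB
  have c1' : ((L \ A).card : ℝ) = L.card - A.card := by
    rw [← c1]; push_cast; ring
  have c2' : ((R \ B).card : ℝ) = L.card - B.card := by
    rw [hLR, ← c2]; push_cast; ring
  have h1' : (u A R : ℝ) ≤ I.card * A.card := by exact_mod_cast h1
  have h2' : (u L B : ℝ) ≤ I.card * B.card := by exact_mod_cast h2
  have h3' : (u (L \ A) (R \ B) : ℝ) ≤ (L.card - A.card) * (L.card - B.card) := by
    rw [← c1', ← c2']; exact_mod_cast h3
  have hGc' : (A.card : ℝ) * B.card = ((A ×ˢ B) ∩ G).card + u A B := by exact_mod_cast hGc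
  have s1' : (u A R : ℝ) = u A B + u A (R \ B) := by exact_mod_cast s1
  have s2' : (S.card : ℝ) = u L B + u L (R \ B) := by rw [← htot]; exact_mod_cast s2
  have s3' : (u L (R \ B) : ℝ) = u A (R \ B) + u (L \ A) (R \ B) := by exact_mod_cast splitL
  linarith

/-- In the layers indexed by `I`, the box `L × R` of `H` contains edge-disjoint matchings which
miss few vertices, the deficiency growing by a factor `1 + 1 / d` with each layer. -/
def BoxGood {n : ℕ} (c d : ℝ) (I L R : Finset (Fin n)) (H : Fin n → Fin n → Fin n → Bool) : Prop :=
  ∃ S : Finset (Fin n × Fin n × Fin n),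
    (∀ t ∈ S, t.1 ∈ I ∧ t.2.1 ∈ L ∧ t.2.2 ∈ R ∧ H t.1 t.2.1 t.2.2 = true) ∧ EdgeDisjointSet S ∧
    (L.card : ℝ) * I.card - S.card + c ≤ c * (1 + 1 / d) ^ I.card ∧
    ∀ i ∈ I, d * ((L.card : ℝ) - (S.filter (fun t => t.1 = i)).card) ≤ c * (1 + 1 / d) ^ I.card

/-- The pairs not covered by `S`. -/
def uncovered {n : ℕ} (S : Finset (Fin n × Fin n × Fin n)) : Finset (Fin n × Fin n) :=
  Finset.univ.filter (fun e => ∀ i, (i, e) ∉ S)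

lemma BoxGood.insert_layer {n : ℕ} {c d : ℝ} (hc : 0 ≤ c) (hd : 0 < d) {I L R : Finset (Fin n)}
    {i₀ : Fin n} (hi₀ : i₀ ∉ I) (hLR : L.card = R.card) (hId : (I.card : ℝ) + d ≤ L.card)
    {H : Fin n → Fin n → Fin n → Bool} {S : Finset (Fin n × Fin n × Fin n)}
    (hsup : ∀ t ∈ S, t.1 ∈ I ∧ t.2.1 ∈ L ∧ t.2.2 ∈ R ∧ H t.1 t.2.1 t.2.2 = true)
    (hS : EdgeDisjointSet S)
    (htot : (L.card : ℝ) * I.card - S.card + c ≤ c * (1 + 1 / d) ^ I.card)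
    (hdeg : ∀ i ∈ I,
      d * ((L.card : ℝ) - (S.filter (fun t => t.1 = i)).card) ≤ c * (1 + 1 / d) ^ I.card)
    (hx : ¬ ∃ A B : Finset (Fin n), c ≤ (((A ×ˢ B) ∩ uncovered S).card : ℝ) ∧
      ∀ e ∈ (A ×ˢ B) ∩ uncovered S, H i₀ e.1 e.2 = false) :
    BoxGood c d (insert i₀ I) L R H := by
  have hcard : (S.card : ℝ) ≤ L.card * I.card := by
    have : S.card ≤ (I ×ˢ L).card := by
      refine Finset.card_le_card_of_injOn (fun t => (t.1, t.2.1)) ?_ ?_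
      · intro t ht
        have := hsup t ht
        simp [this.1, this.2.1]
      · intro t ht t' ht' h
        simp only [Prod.mk.injEq] at h
        exact hS.eq_of_fst_of_snd ht ht' h.1 h.2
    rw [Finset.card_product] at this
    rw [mul_comm]
    exact_mod_cast this
  set E : ℝ := (L.card : ℝ) * I.card - S.card with hE
  have hE0 : 0 ≤ E := by linarith
  set D : ℕ := ⌊(E + c) / d⌋₊ with hD
  have hDle : (D : ℝ) * d ≤ E + c := by
    rw [← le_div_iff₀ hd]
    exact Nat.floor_le (by positivity)
  have hDlt : E + c < ((D : ℝ) + 1) * d := by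
    rw [← div_lt_iff₀ hd]
    exact Nat.lt_floor_add_one _
  have hG : ∀ e, e ∈ uncovered S ↔ ∀ i, (i, e) ∉ S := by simp [uncovered]
  obtain ⟨M, hM, hM1, hM2, hMc⟩ := exists_matching_of_hall L R
    (fun j k => H i₀ j k = true ∧ (j, k) ∈ uncovered S) D (by
      intro A hA
      by_contra hlt
      push Not at hlt
      set N := R.filter (fun k => ∃ j ∈ A, H i₀ j k = true ∧ (j, k) ∈ uncovered S) with hN
      have hNR : N ⊆ R := Finset.filter_subset _ _
      refine hx ⟨A, R \ N, ?_, ?_⟩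
      · have key := card_uncovered_ge hS hLR (fun t ht => ⟨(hsup t ht).1, (hsup t ht).2.1,
          (hsup t ht).2.2.1⟩) hA (Finset.sdiff_subset : R \ N ⊆ R) hG
        refine le_trans ?_ key
        have h1 := Finset.card_sdiff_add_card_eq_card hNR
        have h2 : ((R \ N).card : ℝ) + N.card = L.card := by
          rw [hLR]; exact_mod_cast h1
        have h3 : (N.card : ℝ) + D + 1 ≤ A.card := by
          have hlt' : N.card + D < A.card := by
            refine lt_of_le_of_lt (le_of_eq ?_) hlt
            rw [hN]
            congr!
          exact_mod_cast Nat.succ_le_of_lt hlt'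
        have h4 : (D : ℝ) + 1 ≤ A.card + (R \ N).card - L.card := by linarith
        have h5 : d * ((D : ℝ) + 1) ≤
            ((L.card : ℝ) - I.card) * (A.card + (R \ N).card - L.card) :=
          mul_le_mul (by linarith) h4 (by positivity) (by linarith)
        linarith
      · rintro ⟨j, k⟩ he
        simp only [Finset.mem_inter, Finset.mem_product, Finset.mem_sdiff] at he
        obtain ⟨⟨hj, hk, hkN⟩, hjk⟩ := he
        by_contra hne
        refine hkN (Finset.mem_filter.2 ⟨hk, j, hj, ?_, hjk⟩)
        simpa using hne)
  have hinj : Function.Injective (fun e : Fin n × Fin n => (i₀, e)) := fun a b h => by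
    simpa using h
  have hSi₀ : ∀ t ∈ S, t.1 ≠ i₀ := fun t ht h => hi₀ (h ▸ (hsup t ht).1)
  have hdisj : Disjoint S (M.image (fun e => (i₀, e))) := by
    rw [Finset.disjoint_left]
    intro t ht ht'
    simp only [Finset.mem_image] at ht'
    obtain ⟨e, _, rfl⟩ := ht'
    exact hSi₀ _ ht rfl
  have hcard' : (S ∪ M.image (fun e => (i₀, e))).card = S.card + M.card := by
    rw [Finset.card_union_of_disjoint hdisj, Finset.card_image_of_injective _ hinj]
  have hIc : (insert i₀ I).card = I.card + 1 := Finset.card_insert_of_notMem hi₀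
  have hMc' : (L.card : ℝ) ≤ M.card + D := by exact_mod_cast hMc
  have hpow : c * (1 + 1 / d) ^ I.card ≤ c * (1 + 1 / d) ^ (I.card + 1) := by
    refine mul_le_mul_of_nonneg_left (pow_le_pow_right₀ ?_ (Nat.le_succ _)) hc
    have : 0 < 1 / d := by positivity
    linarith
  refine ⟨S ∪ M.image (fun e => (i₀, e)), ?_, ?_, ?_, ?_⟩
  · intro t ht
    rw [Finset.mem_union, Finset.mem_image] at ht
    rcases ht with ht | ⟨e, he, rfl⟩
    · obtain ⟨h1, h2⟩ := hsup t ht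
      exact ⟨Finset.mem_insert_of_mem h1, h2⟩
    · obtain ⟨h1, h2, h3, -⟩ := hM e he
      exact ⟨Finset.mem_insert_self _ _, h1, h2, h3⟩
  · have hcross : ∀ t ∈ S, ∀ e ∈ M, t.2 ≠ e := by
      rintro t ht e he rfl
      exact (hG _).1 (hM _ he).2.2.2 t.1 ht
    intro t ht t' ht' hne
    rw [Finset.mem_union, Finset.mem_image] at ht ht'
    rcases ht with ht | ⟨e, he, rfl⟩ <;> rcases ht' with ht' | ⟨e', he', rfl⟩
    · exact hS t ht t' ht' hne
    · refine ⟨fun h => hSi₀ t ht h.1, fun h => hSi₀ t ht h.1, fun h => hcross t ht e' he' ?_⟩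
      exact Prod.ext h.1 h.2
    · refine ⟨fun h => hSi₀ t' ht' h.1.symm, fun h => hSi₀ t' ht' h.1.symm,
        fun h => hcross t' ht' e he ?_⟩
      exact Prod.ext h.1.symm h.2.symm
    · refine ⟨fun h => hne ?_, fun h => hne ?_, fun h => hne ?_⟩
      · rw [hM1 e he e' he' h.2]
      · rw [hM2 e he e' he' h.2]
      · rw [hM1 e he e' he' h.1]
  · rw [hcard', hIc]
    have : (E + c) * (1 + 1 / d) ≤ c * (1 + 1 / d) ^ I.card * (1 + 1 / d) :=
      mul_le_mul_of_nonneg_right htot (by positivity)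
    have hDle' : (D : ℝ) ≤ (E + c) / d := by rwa [le_div_iff₀ hd]
    have h3 : (E + c) * (1 + 1 / d) = E + c + (E + c) / d := by ring
    push_cast
    rw [pow_succ]
    linarith
  · intro i hi
    rw [hIc]
    rcases Finset.mem_insert.1 hi with rfl | hi
    · have : M.card ≤ ((S ∪ M.image (fun e => (i, e))).filter (fun t => t.1 = i)).card := by
        rw [← Finset.card_image_of_injective M hinj]
        refine Finset.card_le_card fun t ht => ?_
        rw [Finset.mem_filter, Finset.mem_union]
        refine ⟨Or.inr ht, ?_⟩
        obtain ⟨e, _, rfl⟩ := Finset.mem_image.1 ht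
        rfl
      have this' : (M.card : ℝ) ≤
        ((S ∪ M.image (fun e => (i, e))).filter (fun t => t.1 = i)).card := by exact_mod_cast this
      refine le_trans (mul_le_mul_of_nonneg_left (?_ : _ ≤ (D : ℝ)) hd.le) ?_
      · linarith
      · linarith
    · have : ((S.filter (fun t => t.1 = i)).card : ℝ) ≤
          ((S ∪ M.image (fun e => (i₀, e))).filter (fun t => t.1 = i)).card := by
        exact_mod_cast Finset.card_le_card
          (Finset.filter_subset_filter _ Finset.subset_union_left)
      refine le_trans (mul_le_mul_of_nonneg_left ?_ hd.le) ((hdeg i hi).trans hpow)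
      linarith

/-- A random array fails to be good on a fixed box with exponentially small probability. -/
lemma weightProb_not_boxGood_le {n : ℕ} {p c d : ℝ} (hp0 : 0 ≤ p) (hp1 : p ≤ 1) (hc : 0 ≤ c)
    (hd : 0 < d) {L R : Finset (Fin n)} (hLR : L.card = R.card) (I : Finset (Fin n))
    (hId : (I.card : ℝ) + d ≤ L.card) :
    arrProb n n n p (fun H => ¬ BoxGood c d I L R H) ≤
      I.card * (4 ^ n * Real.exp (-(p * c))) := by
  have hw := matWeight_nonneg (n := n) hp0 hp1
  have hW : ∀ H : Fin n → Fin n → Fin n → Bool, 0 ≤ ∏ i, matWeight p (H i) :=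
    fun H => Finset.prod_nonneg fun i _ => hw _
  induction I using Finset.induction_on with
  | empty =>
    have : ∀ H : Fin n → Fin n → Fin n → Bool, BoxGood c d ∅ L R H := fun H =>
      ⟨∅, by simp, by simp [EdgeDisjointSet], by simp, by simp⟩
    simp [arrProb, this]
  | insert i₀ I hi₀ ih =>
    have hIc : (insert i₀ I).card = I.card + 1 := Finset.card_insert_of_notMem hi₀
    rw [hIc] at hId ⊢
    push_cast at hId ⊢
    have ih := ih (by linarith)
    have hloc : ∀ (H : Fin n → Fin n → Fin n → Bool) (x : Fin n → Fin n → Bool),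
        BoxGood c d I L R (Function.update H i₀ x) → BoxGood c d I L R H := by
      rintro H x ⟨S, h1, h2⟩
      refine ⟨S, fun t ht => ?_, h2⟩
      have := h1 t ht
      have hne : t.1 ≠ i₀ := fun h => hi₀ (h ▸ this.1)
      rwa [Function.update_of_ne hne] at this
    have hloc' : ∀ (H : Fin n → Fin n → Fin n → Bool) (x : Fin n → Fin n → Bool),
        BoxGood c d I L R H → BoxGood c d I L R (Function.update H i₀ x) := by
      intro H x h
      refine hloc _ (H i₀) ?_
      rwa [Function.update_idem, Function.update_eq_self]
    have step : weightProb (fun H : Fin n → Fin n → Fin n → Bool => ∏ i, matWeight p (H i))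
        (fun H => BoxGood c d I L R H ∧ ¬ BoxGood c d (insert i₀ I) L R H) ≤
        4 ^ n * Real.exp (-(p * c)) := by
      refine weightProb_pi_le hw sum_matWeight i₀ _ _ fun H => ?_
      by_cases hH : BoxGood c d I L R H
      · obtain ⟨S, hsup, hS, htot, hdeg⟩ := hH
        refine le_trans (weightProb_mono hw ?_)
          (weightProb_empty_box_le hp0 hp1 (uncovered S) c)
        rintro x ⟨-, hx⟩
        by_contra hcon
        refine hx (BoxGood.insert_layer hc hd hi₀ hLR (by linarith) (S := S) ?_ hS htot hdeg ?_)
        · intro t ht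
          have := hsup t ht
          have hne : t.1 ≠ i₀ := fun h => hi₀ (h ▸ this.1)
          rwa [Function.update_of_ne hne]
        · rwa [Function.update_self]
      · have : ∀ x, ¬ (BoxGood c d I L R (Function.update H i₀ x) ∧
            ¬ BoxGood c d (insert i₀ I) L R (Function.update H i₀ x)) :=
          fun x h => hH (hloc H x h.1)
        simp only [weightProb, this, if_false, Finset.sum_const_zero]
        positivity
    calc arrProb n n n p (fun H => ¬ BoxGood c d (insert i₀ I) L R H)
        ≤ weightProb (fun H : Fin n → Fin n → Fin n → Bool => ∏ i, matWeight p (H i))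
          (fun H => ¬ BoxGood c d I L R H ∨
            (BoxGood c d I L R H ∧ ¬ BoxGood c d (insert i₀ I) L R H)) :=
          weightProb_mono hW fun H h => by tauto
      _ ≤ _ := weightProb_or_le hW _ _
      _ ≤ I.card * (4 ^ n * Real.exp (-(p * c))) + 4 ^ n * Real.exp (-(p * c)) :=
          add_le_add ih step
      _ = _ := by ring

/-- Every box of `H` with sufficiently fewer layers than columns contains edge-disjoint matchings,
one in each layer, which miss few vertices. -/
def BoxProp {n : ℕ} (lam tau : ℝ) (H : Fin n → Fin n → Fin n → Bool) : Prop :=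
  ∀ I L R : Finset (Fin n), L.card = R.card → (I.card : ℝ) + lam * n ≤ L.card →
    ∃ S : Finset (Fin n × Fin n × Fin n),
      (∀ t ∈ S, t.1 ∈ I ∧ t.2.1 ∈ L ∧ t.2.2 ∈ R ∧ H t.1 t.2.1 t.2.2 = true) ∧
      EdgeDisjointSet S ∧
      ∀ i ∈ I, (L.card : ℝ) - tau * n ≤ (S.filter (fun t => t.1 = i)).card

lemma BoxProp.exists_union {n : ℕ} {lam tau : ℝ} {H : Fin n → Fin n → Fin n → Bool}
    (hH : BoxProp lam tau H) {β : Type*} (B : Finset β) (I L R : β → Finset (Fin n))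
    (hLR : ∀ b ∈ B, (L b).card = (R b).card)
    (hIL : ∀ b ∈ B, ((I b).card : ℝ) + lam * n ≤ (L b).card)
    (hsep : ∀ b ∈ B, ∀ b' ∈ B, ∀ i j k i' j' k' : Fin n, i ∈ I b → j ∈ L b → k ∈ R b →
      i' ∈ I b' → j' ∈ L b' → k' ∈ R b' →
      ((i = i' ∧ j = j') ∨ (i = i' ∧ k = k') ∨ (j = j' ∧ k = k')) → b = b') :
    ∃ S : Finset (Fin n × Fin n × Fin n),
      (∀ t ∈ S, (∃ b ∈ B, t.1 ∈ I b ∧ t.2.1 ∈ L b ∧ t.2.2 ∈ R b) ∧ H t.1 t.2.1 t.2.2 = true) ∧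
      EdgeDisjointSet S ∧
      ∀ i, ∑ b ∈ B.filter (fun b => i ∈ I b), (((L b).card : ℝ) - tau * n) ≤
        (S.filter (fun t => t.1 = i)).card := by
  have hT : ∀ b, ∃ S : Finset (Fin n × Fin n × Fin n), b ∈ B →
      (∀ t ∈ S, t.1 ∈ I b ∧ t.2.1 ∈ L b ∧ t.2.2 ∈ R b ∧ H t.1 t.2.1 t.2.2 = true) ∧
      EdgeDisjointSet S ∧
      ∀ i ∈ I b, ((L b).card : ℝ) - tau * n ≤ (S.filter (fun t => t.1 = i)).card := by
    intro b
    by_cases hb : b ∈ B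
    · obtain ⟨S, hS⟩ := hH (I b) (L b) (R b) (hLR b hb) (hIL b hb)
      exact ⟨S, fun _ => hS⟩
    · exact ⟨∅, fun h => absurd h hb⟩
  choose T hT using hT
  have hsep' : ∀ b ∈ B, ∀ b' ∈ B, ∀ t ∈ T b, ∀ t' ∈ T b', ((t.1 = t'.1 ∧ t.2.1 = t'.2.1) ∨
      (t.1 = t'.1 ∧ t.2.2 = t'.2.2) ∨ (t.2.1 = t'.2.1 ∧ t.2.2 = t'.2.2)) → b = b' := by
    intro b hb b' hb' t ht t' ht'
    obtain ⟨h1, h2, h3, -⟩ := (hT b hb).1 t ht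
    obtain ⟨h1', h2', h3', -⟩ := (hT b' hb').1 t' ht'
    exact hsep b hb b' hb' _ _ _ _ _ _ h1 h2 h3 h1' h2' h3'
  refine ⟨B.biUnion T, ?_, ?_, ?_⟩
  · intro t ht
    obtain ⟨b, hb, ht⟩ := Finset.mem_biUnion.1 ht
    obtain ⟨h1, h2, h3, h4⟩ := (hT b hb).1 t ht
    exact ⟨⟨b, hb, h1, h2, h3⟩, h4⟩
  · intro t ht t' ht' hne
    obtain ⟨b, hb, ht⟩ := Finset.mem_biUnion.1 ht
    obtain ⟨b', hb', ht'⟩ := Finset.mem_biUnion.1 ht'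
    by_cases hbb : b = b'
    · subst hbb
      exact (hT b hb).2.1 t ht t' ht' hne
    · have := fun h => hbb (hsep' b hb b' hb' t ht t' ht' h)
      tauto
  · intro i
    have hdisj : Set.PairwiseDisjoint (↑(B.filter (fun b => i ∈ I b)))
        (fun b => (T b).filter (fun t => t.1 = i)) := by
      intro b hb b' hb' hbb
      rw [Function.onFun, Finset.disjoint_left]
      intro t ht ht'
      simp only [Finset.coe_filter, Set.mem_ofPred_eq] at hb hb'
      rw [Finset.mem_filter] at ht ht'
      exact hbb (hsep' b hb.1 b' hb'.1 t ht.1 t ht'.1 (by simp))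
    calc ∑ b ∈ B.filter (fun b => i ∈ I b), (((L b).card : ℝ) - tau * n)
        ≤ ∑ b ∈ B.filter (fun b => i ∈ I b), (((T b).filter (fun t => t.1 = i)).card : ℝ) := by
          refine Finset.sum_le_sum fun b hb => ?_
          rw [Finset.mem_filter] at hb
          exact (hT b hb.1).2.2 i hb.2
      _ = (((B.filter (fun b => i ∈ I b)).biUnion
            (fun b => (T b).filter (fun t => t.1 = i))).card : ℝ) := by
          rw [Finset.card_biUnion hdisj]
          push_cast
          rfl
      _ ≤ _ := by
          refine Nat.cast_le.2 (Finset.card_le_card fun t ht => ?_)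
          obtain ⟨b, hb, ht⟩ := Finset.mem_biUnion.1 ht
          rw [Finset.mem_filter] at ht hb ⊢
          exact ⟨Finset.mem_biUnion.2 ⟨b, hb.1, ht.1⟩, ht.2⟩

lemma card_deficient_mul_le {n : ℕ} {α : Type*} (S : Finset α) (f g : α → Fin n)
    (Q : Fin n → Fin n → Prop) [∀ i x, Decidable (Q i x)] (X δ : ℝ)
    (hrow : ∀ i, ((Finset.univ.filter (fun x => Q i x)).card : ℝ) - X ≤
      (S.filter (fun t => f t = i)).card)
    (hcol : ∀ x, (S.filter (fun t => g t = x)).card ≤ (Finset.univ.filter (fun i => Q i x)).card) :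
    ((Finset.univ.filter (fun x => ((S.filter (fun t => g t = x)).card : ℝ) + δ ≤
      (Finset.univ.filter (fun i => Q i x)).card)).card : ℝ) * δ ≤ n * X := by
  have hf : ∑ i, ((S.filter (fun t => f t = i)).card : ℝ) = S.card := by
    exact_mod_cast (Finset.card_eq_sum_card_fiberwise (fun t _ => Finset.mem_univ (f t))).symm
  have hg : ∑ i, ((S.filter (fun t => g t = i)).card : ℝ) = S.card := by
    exact_mod_cast (Finset.card_eq_sum_card_fiberwise (fun t _ => Finset.mem_univ (g t))).symm
  have hQ : ∑ i, ((Finset.univ.filter (fun x => Q i x)).card : ℝ) =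
      ∑ x, ((Finset.univ.filter (fun i => Q i x)).card : ℝ) := by
    simp only [Finset.card_filter]
    push_cast
    exact Finset.sum_comm
  have h1 : ∑ i, (((Finset.univ.filter (fun x => Q i x)).card : ℝ) - X) ≤ S.card := by
    rw [← hf]
    exact Finset.sum_le_sum fun i _ => hrow i
  rw [Finset.sum_sub_distrib, hQ] at h1
  simp only [Finset.sum_const, Finset.card_univ, Fintype.card_fin, nsmul_eq_mul] at h1
  rw [← nsmul_eq_mul, ← Finset.sum_const]
  calc _ ≤ ∑ x ∈ Finset.univ.filter (fun x => ((S.filter (fun t => g t = x)).card : ℝ) + δ ≤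
          (Finset.univ.filter (fun i => Q i x)).card),
        (((Finset.univ.filter (fun i => Q i x)).card : ℝ) - (S.filter (fun t => g t = x)).card) :=
        Finset.sum_le_sum fun x hx => by
          have := (Finset.mem_filter.1 hx).2
          linarith
    _ ≤ ∑ x, (((Finset.univ.filter (fun i => Q i x)).card : ℝ) -
          (S.filter (fun t => g t = x)).card) :=
        Finset.sum_le_sum_of_subset_of_nonneg (Finset.filter_subset _ _) fun x _ _ => by
          have : ((S.filter (fun t => g t = x)).card : ℝ) ≤
            (Finset.univ.filter (fun i => Q i x)).card := by exact_mod_cast hcol x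
          linarith
    _ ≤ n * X := by
        rw [Finset.sum_sub_distrib, hg]
        linarith

/-- The elements on which `f` takes the value `a`. -/
def fiber {n : ℕ} {G : Type*} (f : Fin n → G) (a : G) : Finset (Fin n) :=
  Finset.univ.filter (fun x => f x = a)

lemma mem_fiber {n : ℕ} {G : Type*} {f : Fin n → G} {a : G} {x : Fin n} :
    x ∈ fiber f a ↔ f x = a := by
  simp [fiber]

lemma card_filter_comp {n s : ℕ} {G : Type*} [Fintype G] {f : Fin n → G} {P : G → Prop}
    [DecidablePred P] (h : ∀ a, P a → (fiber f a).card = s) :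
    (Finset.univ.filter (fun x => P (f x))).card = (Finset.univ.filter P).card * s := by
  rw [Finset.card_eq_sum_card_fiberwise (f := f) (t := Finset.univ.filter P)
    (fun x hx => by simpa using hx), ← smul_eq_mul, ← Finset.sum_const]
  refine Finset.sum_congr rfl fun a ha => ?_
  rw [Finset.mem_filter] at ha
  rw [← h a ha.2]
  congr 1
  ext x
  simp only [Finset.mem_filter, Finset.mem_univ, true_and, mem_fiber]
  exact ⟨fun h => h.2, fun h => ⟨h ▸ ha.2, h⟩⟩

lemma BoxProp.exists_main {n s : ℕ} {lam tau : ℝ} {H : Fin n → Fin n → Fin n → Bool}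
    (hH : BoxProp lam tau H) (htau : 0 ≤ tau) {G : Type*} [Fintype G] [AddCommGroup G]
    (ρ κ : Fin n → G) (hκ : ∀ a, a ≠ 0 → (fiber κ a).card = s)
    (hρ : ∀ r, ((fiber ρ r).card : ℝ) + lam * n ≤ s) :
    ∃ S : Finset (Fin n × Fin n × Fin n),
      (∀ t ∈ S, κ t.2.1 ≠ 0 ∧ κ t.2.2 ≠ 0 ∧ κ t.2.2 = κ t.2.1 + ρ t.1 ∧
        H t.1 t.2.1 t.2.2 = true) ∧
      EdgeDisjointSet S ∧
      ∀ i, (((Finset.univ.filter (fun x => κ x ≠ 0 ∧ κ x + ρ i ≠ 0)).card : ℝ)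
          - Fintype.card G * tau * n ≤ (S.filter (fun t => t.1 = i)).card) ∧
        (((Finset.univ.filter (fun x => κ x ≠ 0 ∧ κ x - ρ i ≠ 0)).card : ℝ)
          - Fintype.card G * tau * n ≤ (S.filter (fun t => t.1 = i)).card) := by
  obtain ⟨S, hS, hS', hdeg⟩ := hH.exists_union
    (Finset.univ.filter (fun b : G × G => b.2 ≠ 0 ∧ b.2 + b.1 ≠ 0))
    (fun b => fiber ρ b.1) (fun b => fiber κ b.2) (fun b => fiber κ (b.2 + b.1))
    (fun b hb => by
      rw [Finset.mem_filter] at hb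
      rw [hκ _ hb.2.1, hκ _ hb.2.2])
    (fun b hb => by
      rw [Finset.mem_filter] at hb
      rw [hκ _ hb.2.1]
      exact hρ _)
    (by
      rintro ⟨r, a⟩ - ⟨r', a'⟩ - i j k i' j' k' hi hj hk hi' hj' hk' h
      rw [mem_fiber] at hi hj hk hi' hj' hk'
      simp only at hi hj hk hi' hj' hk'
      rcases h with ⟨rfl, rfl⟩ | ⟨rfl, rfl⟩ | ⟨rfl, rfl⟩
      · rw [← hi, ← hj, ← hi', ← hj']
      · rw [hk, ← hi, ← hi', add_left_inj] at hk'
        rw [← hi, ← hi', hk']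
      · rw [hk, ← hj, ← hj', add_right_inj] at hk'
        rw [← hj, ← hj', hk'])
  refine ⟨S, ?_, hS', ?_⟩
  · intro t ht
    obtain ⟨⟨b, hb, h1, h2, h3⟩, h4⟩ := hS t ht
    rw [mem_fiber] at h1 h2 h3
    rw [Finset.mem_filter] at hb
    rw [h3, h2, h1]
    exact ⟨hb.2.1, hb.2.2, rfl, h4⟩
  · intro i
    set N := (Finset.univ.filter (fun a : G => a ≠ 0 ∧ a + ρ i ≠ 0)).card with hN
    have hNle : (N : ℝ) ≤ Fintype.card G := by exact_mod_cast Finset.card_le_univ _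
    have hN' : (Finset.univ.filter (fun a : G => a ≠ 0 ∧ a - ρ i ≠ 0)).card = N := by
      refine Finset.card_nbij' (fun a => a - ρ i) (fun a => a + ρ i) ?_ ?_ ?_ ?_
      all_goals intro a ha; simp_all
    have hsum : (N : ℝ) * (s - tau * n) ≤ (S.filter (fun t => t.1 = i)).card := by
      refine le_trans (le_of_eq ?_) (hdeg i)
      have hBN : ((Finset.univ.filter (fun b : G × G => b.2 ≠ 0 ∧ b.2 + b.1 ≠ 0)).filter
          (fun b => i ∈ fiber ρ b.1)).card = N := by
        refine Finset.card_nbij' (fun b => b.2) (fun a => (ρ i, a)) ?_ ?_ ?_ ?_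
        · rintro ⟨r, a⟩ h
          simp only [Finset.coe_filter, Set.mem_ofPred_eq, Finset.mem_filter, mem_fiber] at h ⊢
          rw [h.2]
          exact ⟨Finset.mem_univ _, h.1.2⟩
        · intro a h
          simp only [Finset.coe_filter, Set.mem_ofPred_eq, Finset.mem_filter, mem_fiber,
            Finset.mem_univ, true_and] at h ⊢
          exact ⟨h, trivial⟩
        · rintro ⟨r, a⟩ h
          simp only [Finset.coe_filter, Set.mem_ofPred_eq, Finset.mem_filter, mem_fiber] at h
          simp [h.2]
        · intro a _
          rfl
      rw [← hBN, ← nsmul_eq_mul, ← Finset.sum_const]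
      refine Finset.sum_congr rfl fun b hb => ?_
      rw [Finset.mem_filter, Finset.mem_filter] at hb
      rw [hκ _ hb.1.2.1]
    have h5 : (N : ℝ) * (tau * n) ≤ Fintype.card G * (tau * n) :=
      mul_le_mul_of_nonneg_right hNle (by positivity)
    have h6 : (Finset.univ.filter (fun x => κ x ≠ 0 ∧ κ x + ρ i ≠ 0)).card = N * s := by
      rw [hN]
      convert card_filter_comp (f := κ) (P := fun a => a ≠ 0 ∧ a + ρ i ≠ 0) fun a ha => hκ a ha.1
    have h7 : (Finset.univ.filter (fun x => κ x ≠ 0 ∧ κ x - ρ i ≠ 0)).card = N * s := by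
      rw [← hN']
      convert card_filter_comp (f := κ) (P := fun a => a ≠ 0 ∧ a - ρ i ≠ 0) fun a ha => hκ a ha.1
    rw [h6, h7]
    push_cast
    constructor <;> linarith

lemma BoxProp.exists_fix {n s w : ℕ} {lam tau : ℝ} {H : Fin n → Fin n → Fin n → Bool}
    (hH : BoxProp lam tau H) (htau : 0 ≤ tau) {G : Type*} [Fintype G] [Zero G]
    {ρ κ : Fin n → G} {I J : Finset (Fin n)} (hρ : ∀ r, r ≠ 0 → (fiber ρ r).card = w)
    (hκ : ∀ r, r ≠ 0 → (fiber κ r).card = s) (hI : (I.card : ℝ) + lam * n ≤ w)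
    (hJ : w + J.card ≤ s) :
    ∃ S : Finset (Fin n × Fin n × Fin n),
      (∀ t ∈ S, t.1 ∈ I ∧ t.2.2 ∉ J ∧ κ t.2.2 ≠ 0 ∧ κ t.2.2 = ρ t.2.1 ∧
        H t.1 t.2.1 t.2.2 = true) ∧
      EdgeDisjointSet S ∧
      ∀ i ∈ I, (n : ℝ) - (fiber ρ 0).card - Fintype.card G * tau * n ≤
        (S.filter (fun t => t.1 = i)).card := by
  have hR : ∀ r, ∃ R : Finset (Fin n), r ≠ 0 → R ⊆ fiber κ r \ J ∧ R.card = w := by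
    intro r
    by_cases hr : r = 0
    · exact ⟨∅, fun h => absurd hr h⟩
    · have h1 : w ≤ (fiber κ r \ J).card := by
        have := Finset.le_card_sdiff J (fiber κ r)
        rw [hκ r hr] at this
        omega
      obtain ⟨R, hR⟩ := Finset.exists_subset_card_eq h1
      exact ⟨R, fun _ => hR⟩
  choose R hR using hR
  obtain ⟨S, hS, hS', hdeg⟩ := hH.exists_union (Finset.univ.filter (fun r : G => r ≠ 0))
    (fun _ => I) (fiber ρ) R
    (fun r hr => by
      rw [Finset.mem_filter] at hr
      rw [hρ r hr.2, (hR r hr.2).2])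
    (fun r hr => by
      rw [Finset.mem_filter] at hr
      rw [hρ r hr.2]
      exact hI)
    (by
      intro r hr r' hr' i j k i' j' k' hi hj hk hi' hj' hk' h
      rw [Finset.mem_filter] at hr hr'
      have hk := (hR r hr.2).1 hk
      have hk' := (hR r' hr'.2).1 hk'
      rw [Finset.mem_sdiff] at hk hk'
      rw [mem_fiber] at hj hk hj' hk'
      rcases h with ⟨rfl, rfl⟩ | ⟨rfl, rfl⟩ | ⟨rfl, rfl⟩
      · rw [← hj, ← hj']
      · rw [← hk.1, ← hk'.1]
      · rw [← hj, ← hj'])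
  refine ⟨S, ?_, hS', ?_⟩
  · intro t ht
    obtain ⟨⟨r, hr, h1, h2, h3⟩, h4⟩ := hS t ht
    rw [Finset.mem_filter] at hr
    have h3 := (hR r hr.2).1 h3
    rw [Finset.mem_sdiff] at h3
    rw [mem_fiber] at h2 h3
    exact ⟨h1, h3.2, h3.1 ▸ hr.2, h3.1.trans h2.symm, h4⟩
  · intro i hi
    refine le_trans ?_ (hdeg i)
    set N := (Finset.univ.filter (fun r : G => r ≠ 0)).card with hN
    have hNle : (N : ℝ) ≤ Fintype.card G := by exact_mod_cast Finset.card_le_univ _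
    have h6 : (Finset.univ.filter (fun x => ρ x ≠ 0)).card = N * w := by
      rw [hN]
      convert card_filter_comp (f := ρ) (P := fun r => r ≠ 0) hρ
    have h7 : (fiber ρ 0).card + (Finset.univ.filter (fun x => ρ x ≠ 0)).card = n := by
      have := Finset.card_filter_add_card_filter_not (s := (Finset.univ : Finset (Fin n)))
        (fun x => ρ x = 0)
      rw [Finset.card_univ, Fintype.card_fin] at this
      refine Eq.trans ?_ this
      congr!
    have h8 : ((fiber ρ 0).card : ℝ) + N * w = n := by
      rw [h6] at h7
      exact_mod_cast h7
    have h5 : (N : ℝ) * (tau * n) ≤ Fintype.card G * (tau * n) :=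
      mul_le_mul_of_nonneg_right hNle (by positivity)
    have h9 : ∑ r ∈ (Finset.univ.filter (fun r : G => r ≠ 0)).filter (fun _ => i ∈ I),
        (((fiber ρ r).card : ℝ) - tau * n) = N * (w - tau * n) := by
      rw [Finset.filter_true_of_mem (fun _ _ => hi), hN, ← nsmul_eq_mul, ← Finset.sum_const]
      refine Finset.sum_congr rfl fun r hr => ?_
      rw [Finset.mem_filter] at hr
      rw [hρ r hr.2]
    rw [h9]
    linarith

lemma card_low_degree_le {n m s : ℕ} {α : Type*} {G : Type*} [AddCommGroup G] {S : Finset α}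
    {f g : α → Fin n} {σ κ : Fin n → G} {X δ D : ℝ} (hδ : 0 ≤ δ)
    (hS : ∀ t ∈ S, κ (g t) ≠ 0 ∧ κ (g t) + σ (f t) ≠ 0)
    (hinj : ∀ t ∈ S, ∀ t' ∈ S, f t = f t' → g t = g t' → t = t')
    (hrow : ∀ i, ((Finset.univ.filter (fun x => κ x ≠ 0 ∧ κ x + σ i ≠ 0)).card : ℝ) - X ≤
      (S.filter (fun t => f t = i)).card)
    (hκ : (fiber κ 0).card ≤ m) (hσ : ∀ r, (fiber σ r).card ≤ s) (hD : D + δ ≤ n - s) :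
    (((Finset.univ.filter (fun x => ((S.filter (fun t => g t = x)).card : ℝ) < D)).card : ℝ) - m)
      * δ ≤ n * X := by
  have key := card_deficient_mul_le S f g (fun i x => κ x ≠ 0 ∧ κ x + σ i ≠ 0) X δ hrow (by
    intro x
    refine Finset.card_le_card_of_injOn f ?_ ?_
    · intro t ht
      simp only [Finset.coe_filter, Set.mem_ofPred_eq] at ht ⊢
      obtain ⟨h1, rfl⟩ := ht
      exact ⟨Finset.mem_univ _, hS t h1⟩
    · intro t ht t' ht' h
      simp only [Finset.coe_filter, Set.mem_ofPred_eq] at ht ht'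
      exact hinj t ht.1 t' ht'.1 h (ht.2.trans ht'.2.symm))
  refine le_trans (mul_le_mul_of_nonneg_right ?_ hδ) key
  rw [sub_le_iff_le_add]
  have hsub : Finset.univ.filter (fun x => ((S.filter (fun t => g t = x)).card : ℝ) < D) ⊆
      Finset.univ.filter (fun x => ((S.filter (fun t => g t = x)).card : ℝ) + δ ≤
        (Finset.univ.filter (fun i => κ x ≠ 0 ∧ κ x + σ i ≠ 0)).card) ∪ fiber κ 0 := by
    intro x hx
    rw [Finset.mem_filter] at hx
    rw [Finset.mem_union, Finset.mem_filter, mem_fiber]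
    by_cases h0 : κ x = 0
    · exact Or.inr h0
    · refine Or.inl ⟨Finset.mem_univ _, ?_⟩
      have h1 : n ≤ (Finset.univ.filter (fun i => κ x ≠ 0 ∧ κ x + σ i ≠ 0)).card +
          (fiber σ (-κ x)).card := by
        refine le_trans (Finset.card_fin n).ge
          (le_trans (Finset.card_le_card fun i _ => ?_) (Finset.card_union_le _ _))
        rw [Finset.mem_union, Finset.mem_filter, mem_fiber]
        by_cases hi : κ x + σ i = 0
        · exact Or.inr (eq_neg_of_add_eq_zero_right hi)
        · exact Or.inl ⟨Finset.mem_univ _, h0, hi⟩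
      have h2 : (n : ℝ) ≤ (Finset.univ.filter (fun i => κ x ≠ 0 ∧ κ x + σ i ≠ 0)).card + s := by
        exact_mod_cast h1.trans (Nat.add_le_add_left (hσ _) _)
      linarith [hx.2]
  have := (Finset.card_le_card hsub).trans (Finset.card_union_le _ _)
  exact_mod_cast this.trans (Nat.add_le_add_left hκ _)

lemma card_filter_and_mem_le {n : ℕ} {α : Type*} {S : Finset α} {f g : α → Fin n}
    (hinj : ∀ t ∈ S, ∀ t' ∈ S, f t = f t' → g t = g t' → t = t') (i : Fin n)
    (B : Finset (Fin n)) : (S.filter (fun t => f t = i ∧ g t ∈ B)).card ≤ B.card := by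
  refine Finset.card_le_card_of_injOn g ?_ ?_
  · intro t ht
    simp only [Finset.coe_filter, Set.mem_ofPred_eq] at ht
    exact ht.2.2
  · intro t ht t' ht' h
    simp only [Finset.coe_filter, Set.mem_ofPred_eq] at ht ht'
    exact hinj t ht.1 t' ht'.1 (ht.2.1.trans ht'.2.1.symm) h

lemma edgeDisjointSet_of_unique {n : ℕ} {S : Finset (Fin n × Fin n × Fin n)}
    (h1 : ∀ i j k k', (i, j, k) ∈ S → (i, j, k') ∈ S → k = k')
    (h2 : ∀ i j j' k, (i, j, k) ∈ S → (i, j', k) ∈ S → j = j')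
    (h3 : ∀ i i' j k, (i, j, k) ∈ S → (i', j, k) ∈ S → i = i') : EdgeDisjointSet S := by
  rintro ⟨i, j, k⟩ ht ⟨i', j', k'⟩ ht' hne
  refine ⟨?_, ?_, ?_⟩
  · rintro ⟨rfl, rfl⟩
    exact hne (by rw [h1 _ _ _ _ ht ht'])
  · rintro ⟨rfl, rfl⟩
    exact hne (by rw [h2 _ _ _ _ ht ht'])
  · rintro ⟨rfl, rfl⟩
    exact hne (by rw [h3 _ _ _ _ ht ht'])

/-- The conclusion of the main theorem: the triangles of `H` contain edge-disjoint triangles which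
cover almost all of the pairs at every vertex. -/
def HasNearDecomposition {n : ℕ} (γ : ℝ) (H : Fin n → Fin n → Fin n → Bool) : Prop :=
  ∃ S : Finset (Fin n × Fin n × Fin n),
    (∀ t ∈ S, H t.1 t.2.1 t.2.2 = true) ∧ EdgeDisjointSet S ∧
    (∀ v : Fin n,
      (1 - γ) * n ≤ ((S.filter (fun t => t.1 = v)).card : ℝ) ∧
      (1 - γ) * n ≤ ((S.filter (fun t => t.2.1 = v)).card : ℝ) ∧
      (1 - γ) * n ≤ ((S.filter (fun t => t.2.2 = v)).card : ℝ))

lemma card_fiber_neg_comp {n : ℕ} {G : Type*} [AddCommGroup G] (f : Fin n → G) (a : G) :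
    (fiber (fun x => -f x) a).card = (fiber f (-a)).card := by
  congr 1
  ext x
  simp [mem_fiber, neg_eq_iff_eq_neg]

lemma card_le_of_sub_mul_le {n m : ℕ} {B : Finset (Fin n)} {δ X b : ℝ} (hδ : 0 < δ)
    (h : ((B.card : ℝ) - m) * δ ≤ n * X) (hb : n * X ≤ (b - m) * δ) : (B.card : ℝ) ≤ b := by
  have := le_of_mul_le_mul_right (h.trans hb) hδ
  linarith

lemma le_card_filter_add_card_fiber {n : ℕ} {G : Type*} [AddCommGroup G] (κ : Fin n → G) (r : G) :
    n ≤ (Finset.univ.filter (fun x => κ x ≠ 0 ∧ κ x + r ≠ 0)).card + (fiber κ 0).card +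
      (fiber κ (-r)).card := by
  refine le_trans (Finset.card_fin n).ge (le_trans (Finset.card_le_card fun x _ => ?_)
    ((Finset.card_union_le _ _).trans (Nat.add_le_add_right (Finset.card_union_le _ _) _)))
  rw [Finset.mem_union, Finset.mem_union, Finset.mem_filter, mem_fiber, mem_fiber]
  by_cases h0 : κ x = 0
  · exact Or.inl (Or.inr h0)
  by_cases h1 : κ x + r = 0
  · exact Or.inr (eq_neg_of_add_eq_zero_left h1)
  · exact Or.inl (Or.inl ⟨Finset.mem_univ _, h0, h1⟩)

set_option maxHeartbeats 800000 in
theorem hasNearDecomposition_of_boxProp {n s w m : ℕ} {lam tau γ b δ : ℝ}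
    {H : Fin n → Fin n → Fin n → Bool} (htau : 0 ≤ tau) (hlam : 0 ≤ lam)
    {G : Type*} [Fintype G] [AddCommGroup G] (hG : Fintype.card G = m) (ρ κ : Fin n → G)
    (hH : BoxProp lam tau H) (hH' : BoxProp lam tau (fun j i k => H i j k))
    (hH'' : BoxProp lam tau (fun k i j => H i j k))
    (hκ : ∀ a, a ≠ 0 → (fiber κ a).card = s) (hκ0 : (fiber κ 0).card ≤ m)
    (hρ : ∀ r, r ≠ 0 → (fiber ρ r).card = w)
    (hρ' : ∀ r, ((fiber ρ r).card : ℝ) + lam * n ≤ s)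
    (hδ : 0 < δ) (hδs : (1 - γ / 2) * n + δ ≤ n - s)
    (hb : n * (m * tau * n) ≤ (b - m) * δ) (hbw : b + lam * n ≤ w) (hws : w + b ≤ s)
    (hγ : m + s + m * tau * n + 2 * b ≤ γ * n) : HasNearDecomposition γ H := by
  obtain ⟨S, hS, hSd, hSr⟩ := hH.exists_main htau ρ κ hκ hρ'
  rw [hG] at hSr
  have hρs : ∀ r, (fiber ρ r).card ≤ s := fun r => by
    have := hρ' r
    have h2 : 0 ≤ lam * n := by positivity
    exact_mod_cast (by linarith : ((fiber ρ r).card : ℝ) ≤ s)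
  have hκs : ∀ a, (fiber κ a).card ≤ s := fun a => by
    by_cases h : a = 0
    · rw [h]
      have h1 : 0 ≤ (b - m) * δ := le_trans (by positivity) hb
      have h2 : 0 ≤ b - m := nonneg_of_mul_nonneg_left h1 hδ
      have h3 : (0 : ℝ) ≤ w := by positivity
      exact hκ0.trans (by exact_mod_cast (by linarith : (m : ℝ) ≤ s))
    · exact (hκ a h).le
  have h12 : ∀ t ∈ S, ∀ t' ∈ S, t.1 = t'.1 → t.2.1 = t'.2.1 → t = t' :=
    fun t ht t' ht' => hSd.eq_of_fst_of_snd ht ht'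
  have h13 : ∀ t ∈ S, ∀ t' ∈ S, t.1 = t'.1 → t.2.2 = t'.2.2 → t = t' :=
    fun t ht t' ht' => hSd.eq_of_fst_of_trd ht ht'
  have h23 : ∀ t ∈ S, ∀ t' ∈ S, t.2.1 = t'.2.1 → t.2.2 = t'.2.2 → t = t' :=
    fun t ht t' ht' => hSd.eq_of_snd_of_trd ht ht'
  set C : Finset (Fin n) := Finset.univ.filter
    (fun x => ((S.filter (fun t => t.2.1 = x)).card : ℝ) < (1 - γ / 2) * n) with hC
  set Y : Finset (Fin n) := Finset.univ.filter
    (fun x => ((S.filter (fun t => t.2.2 = x)).card : ℝ) < (1 - γ / 2) * n) with hY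
  have hCb : (C.card : ℝ) ≤ b := by
    have h1 : ∀ t ∈ S, κ t.2.1 ≠ 0 ∧ κ t.2.1 + ρ t.1 ≠ 0 := by
      intro t ht
      obtain ⟨h1, h2, h3, -⟩ := hS t ht
      exact ⟨h1, h3 ▸ h2⟩
    have h2 := card_low_degree_le hδ.le h1 h12 (fun i => (hSr i).1) hκ0 hρs hδs
    exact card_le_of_sub_mul_le hδ h2 hb
  have hYb : (Y.card : ℝ) ≤ b := by
    have h1 : ∀ t ∈ S, κ t.2.2 ≠ 0 ∧ κ t.2.2 + -ρ t.1 ≠ 0 := by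
      intro t ht
      obtain ⟨h1, h2, h3, -⟩ := hS t ht
      refine ⟨h2, ?_⟩
      rw [h3, add_neg_cancel_right]
      exact h1
    have h2 := fun i => (hSr i).2
    simp only [sub_eq_add_neg (κ _)] at h2
    have h3 := card_low_degree_le (σ := fun i => -ρ i) hδ.le h1 h13 h2 hκ0
      (fun r => (card_fiber_neg_comp ρ r).trans_le (hρs _)) hδs
    exact card_le_of_sub_mul_le hδ h3 hb
  have hwC : w + C.card ≤ s := by exact_mod_cast (by linarith : (w : ℝ) + C.card ≤ s)
  have hwY : w + Y.card ≤ s := by exact_mod_cast (by linarith : (w : ℝ) + Y.card ≤ s)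
  obtain ⟨T, hT, hTd, hTdeg⟩ := hH'.exists_fix htau (I := C) (J := Y) hρ hκ (by linarith) hwY
  obtain ⟨U, hU, hUd, hUdeg⟩ := hH''.exists_fix htau (I := Y) (J := C) (κ := fun x => -κ x) hρ
    (fun r hr => by
      rw [card_fiber_neg_comp]
      exact hκ _ (neg_ne_zero.2 hr)) (by linarith) hwC
  rw [hG] at hTdeg hUdeg
  set F : Finset (Fin n × Fin n × Fin n) := Finset.univ.filter (fun t =>
    (t ∈ S ∧ t.2.1 ∉ C ∧ t.2.2 ∉ Y) ∨ (t.2.1, t.1, t.2.2) ∈ T ∨ (t.2.2, t.1, t.2.1) ∈ U) with hF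
  have hmem : ∀ t, t ∈ F ↔ (t ∈ S ∧ t.2.1 ∉ C ∧ t.2.2 ∉ Y) ∨ (t.2.1, t.1, t.2.2) ∈ T ∨
      (t.2.2, t.1, t.2.1) ∈ U := fun t => by simp [hF]
  have hS' : ∀ i j k, (i, j, k) ∈ S → κ j ≠ 0 ∧ κ k ≠ 0 ∧ κ k = κ j + ρ i ∧ H i j k = true :=
    fun i j k h => hS _ h
  have hT' : ∀ i j k, (j, i, k) ∈ T → j ∈ C ∧ k ∉ Y ∧ κ k ≠ 0 ∧ κ k = ρ i ∧ H i j k = true :=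
    fun i j k h => hT _ h
  have hU' : ∀ i j k, (k, i, j) ∈ U → k ∈ Y ∧ j ∉ C ∧ -κ j ≠ 0 ∧ -κ j = ρ i ∧ H i j k = true :=
    fun i j k h => hU _ h
  have hST : ∀ i j j' k, (i, j, k) ∈ S → (j', i, k) ∉ T := fun i j j' k h h' => by
    obtain ⟨h1, -, h3, -⟩ := hS' _ _ _ h
    obtain ⟨-, -, -, h4, -⟩ := hT' _ _ _ h'
    rw [h4] at h3
    exact h1 (by simpa using h3)
  have hSU : ∀ i j k k', (i, j, k) ∈ S → (k', i, j) ∉ U := fun i j k k' h h' => by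
    obtain ⟨-, h2, h3, -⟩ := hS' _ _ _ h
    obtain ⟨-, -, -, h4, -⟩ := hU' _ _ _ h'
    rw [← h4, add_neg_cancel] at h3
    exact h2 h3
  refine ⟨F, ?_, ?_, ?_⟩
  · rintro ⟨i, j, k⟩ ht
    rcases (hmem _).1 ht with ⟨h, -⟩ | h | h
    · exact (hS _ h).2.2.2
    · exact (hT _ h).2.2.2.2
    · exact (hU _ h).2.2.2.2
  · refine edgeDisjointSet_of_unique ?_ ?_ ?_
    · intro i j k k' h h'
      rw [hmem] at h h'
      rcases h with ⟨h, hj, hk⟩ | h | h <;> rcases h' with ⟨h', hj', hk'⟩ | h' | h'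
      · simpa using hSd.eq_of_fst_of_snd h h' rfl rfl
      · exact absurd (hT' _ _ _ h').1 hj
      · exact absurd h' (hSU _ _ _ _ h)
      · exact absurd (hT' _ _ _ h).1 hj'
      · simpa using hTd.eq_of_fst_of_snd h h' rfl rfl
      · exact absurd (hT' _ _ _ h).1 (hU' _ _ _ h').2.1
      · exact absurd h (hSU _ _ _ _ h')
      · exact absurd (hT' _ _ _ h').1 (hU' _ _ _ h).2.1
      · simpa using hUd.eq_of_snd_of_trd h h' rfl rfl
    · intro i j j' k h h'
      rw [hmem] at h h'
      rcases h with ⟨h, hj, hk⟩ | h | h <;> rcases h' with ⟨h', hj', hk'⟩ | h' | h'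
      · simpa using hSd.eq_of_fst_of_trd h h' rfl rfl
      · exact absurd h' (hST _ _ _ _ h)
      · exact absurd (hU' _ _ _ h').1 hk
      · exact absurd h (hST _ _ _ _ h')
      · simpa using hTd.eq_of_snd_of_trd h h' rfl rfl
      · exact absurd (hU' _ _ _ h').1 (hT' _ _ _ h).2.1
      · exact absurd (hU' _ _ _ h).1 hk'
      · exact absurd (hU' _ _ _ h).1 (hT' _ _ _ h').2.1
      · simpa using hUd.eq_of_fst_of_snd h h' rfl rfl
    · intro i i' j k h h'
      rw [hmem] at h h'
      rcases h with ⟨h, hj, hk⟩ | h | h <;> rcases h' with ⟨h', hj', hk'⟩ | h' | h'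
      · simpa using hSd.eq_of_snd_of_trd h h' rfl rfl
      · exact absurd (hT' _ _ _ h').1 hj
      · exact absurd (hU' _ _ _ h').1 hk
      · exact absurd (hT' _ _ _ h).1 hj'
      · simpa using hTd.eq_of_fst_of_trd h h' rfl rfl
      · exact absurd (hU' _ _ _ h').1 (hT' _ _ _ h).2.1
      · exact absurd (hU' _ _ _ h).1 hk'
      · exact absurd (hU' _ _ _ h).1 (hT' _ _ _ h').2.1
      · simpa using hUd.eq_of_fst_of_trd h h' rfl rfl
  · intro v
    have hmτ : 0 ≤ m * tau * n := by positivity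
    have hm0 : (0 : ℝ) ≤ m := by positivity
    have hs0 : (0 : ℝ) ≤ s := by positivity
    have hb0 : 0 ≤ b := le_trans (by positivity) hCb
    have hsplit : ∀ f : Fin n × Fin n × Fin n → Fin n, (S.filter (fun t => f t = v)).card ≤
        (F.filter (fun t => f t = v)).card + (S.filter (fun t => f t = v ∧ t.2.1 ∈ C)).card +
          (S.filter (fun t => f t = v ∧ t.2.2 ∈ Y)).card := by
      intro f
      refine le_trans (Finset.card_le_card fun t ht => ?_)
        ((Finset.card_union_le _ _).trans (Nat.add_le_add_right (Finset.card_union_le _ _) _))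
      rw [Finset.mem_filter] at ht
      simp only [Finset.mem_union, Finset.mem_filter, hmem]
      tauto
    have hfix : (n : ℝ) - (fiber ρ 0).card - m * tau * n ≥ (1 - γ) * n := by
      have : ((fiber ρ 0).card : ℝ) ≤ s := by exact_mod_cast hρs 0
      linarith
    refine ⟨?_, ?_, ?_⟩
    · have h1 := le_card_filter_add_card_fiber κ (ρ v)
      have h2 := (hSr v).1
      have h3 := hsplit (fun t => t.1)
      have h4 := card_filter_and_mem_le h12 v C
      have h5 := card_filter_and_mem_le h13 v Y
      have h6 : ((S.filter (fun t => t.1 = v)).card : ℝ) ≤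
          (F.filter (fun t => t.1 = v)).card + C.card + Y.card := by
        exact_mod_cast h3.trans (by gcongr)
      have h1' : (n : ℝ) ≤
          (Finset.univ.filter (fun x => κ x ≠ 0 ∧ κ x + ρ v ≠ 0)).card + m + s := by
        have h7 := h1.trans (Nat.add_le_add (Nat.add_le_add_left hκ0 _) (hκs (-ρ v)))
        exact_mod_cast h7
      linarith
    · by_cases hv : v ∈ C
      · refine (hfix.le.trans (hTdeg v hv)).trans (Nat.cast_le.2 ?_)
        refine Finset.card_le_card_of_injOn (fun t => (t.2.1, t.1, t.2.2)) ?_ ?_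
        · rintro ⟨j, i, k⟩ ht
          simp only [Finset.coe_filter, Set.mem_ofPred_eq, hmem] at ht ⊢
          exact ⟨Or.inr (Or.inl ht.1), ht.2⟩
        · rintro ⟨j, i, k⟩ - ⟨j', i', k'⟩ - h
          simp only [Prod.mk.injEq] at h ⊢
          tauto
      · have h2 : (1 - γ / 2) * n ≤ (S.filter (fun t => t.2.1 = v)).card := by
          simpa [hC] using hv
        have h3 := hsplit (fun t => t.2.1)
        have h4 : S.filter (fun t => t.2.1 = v ∧ t.2.1 ∈ C) = ∅ := by
          refine Finset.filter_eq_empty_iff.2 fun t _ h => hv (h.1 ▸ h.2)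
        have h5 := card_filter_and_mem_le h23 v Y
        rw [h4, Finset.card_empty] at h3
        have h6 : ((S.filter (fun t => t.2.1 = v)).card : ℝ) ≤
            (F.filter (fun t => t.2.1 = v)).card + 0 + Y.card := by
          exact_mod_cast h3.trans (by gcongr)
        linarith
    · by_cases hv : v ∈ Y
      · refine (hfix.le.trans (hUdeg v hv)).trans (Nat.cast_le.2 ?_)
        refine Finset.card_le_card_of_injOn (fun t => (t.2.1, t.2.2, t.1)) ?_ ?_
        · rintro ⟨k, i, j⟩ ht
          simp only [Finset.coe_filter, Set.mem_ofPred_eq, hmem] at ht ⊢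
          exact ⟨Or.inr (Or.inr ht.1), ht.2⟩
        · rintro ⟨j, i, k⟩ - ⟨j', i', k'⟩ - h
          simp only [Prod.mk.injEq] at h ⊢
          tauto
      · have h2 : (1 - γ / 2) * n ≤ (S.filter (fun t => t.2.2 = v)).card := by
          simpa [hY] using hv
        have h3 := hsplit (fun t => t.2.2)
        have h4 : S.filter (fun t => t.2.2 = v ∧ t.2.2 ∈ Y) = ∅ := by
          refine Finset.filter_eq_empty_iff.2 fun t _ h => hv (h.1 ▸ h.2)
        have h5 := card_filter_and_mem_le (f := fun t => t.2.2) (g := fun t => t.2.1)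
          (fun t ht t' ht' h h' => h23 t ht t' ht' h' h) v C
        rw [h4, Finset.card_empty] at h3
        have h6 : ((S.filter (fun t => t.2.2 = v)).card : ℝ) ≤
            (F.filter (fun t => t.2.2 = v)).card + C.card + 0 := by
          exact_mod_cast h3.trans (by gcongr)
        linarith

lemma exists_card_fiber_eq {n s : ℕ} (G : Type*) [Fintype G] [Zero G]
    (h : (Fintype.card G - 1) * s ≤ n) :
    ∃ f : Fin n → G, ∀ a, a ≠ 0 → (fiber f a).card = s := by
  obtain ⟨e⟩ : Nonempty ({a : G // a ≠ 0} × Fin s ↪ Fin n) := by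
    refine Function.Embedding.nonempty_of_card_le ?_
    simpa [Fintype.card_subtype_compl] using h
  refine ⟨Function.extend e (fun y => y.1.1) (fun _ => 0), fun a ha => ?_⟩
  have : fiber (Function.extend e (fun y => y.1.1) (fun _ => (0 : G))) a =
      Finset.univ.image (fun i : Fin s => e (⟨a, ha⟩, i)) := by
    ext x
    rw [mem_fiber, Finset.mem_image]
    constructor
    · intro hx
      by_cases hy : ∃ y, e y = x
      · obtain ⟨⟨⟨c, hc⟩, i⟩, rfl⟩ := hy
        rw [e.injective.extend_apply] at hx
        simp only at hx
        subst hx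
        exact ⟨i, Finset.mem_univ _, rfl⟩
      · rw [Function.extend_apply' _ _ _ hy] at hx
        exact absurd hx.symm ha
    · rintro ⟨i, -, rfl⟩
      rw [e.injective.extend_apply]
  rw [this, Finset.card_image_of_injective _ fun i i' hi => by simpa using e.injective hi,
    Finset.card_fin]

lemma card_fiber_zero_add {n s : ℕ} {G : Type*} [Fintype G] [Zero G] {f : Fin n → G}
    (hf : ∀ a, a ≠ 0 → (fiber f a).card = s) :
    (fiber f 0).card + (Fintype.card G - 1) * s = n := by
  have h1 : n = ∑ a : G, (fiber f a).card := by
    have := Finset.card_eq_sum_card_fiberwise (s := (Finset.univ : Finset (Fin n)))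
      (t := (Finset.univ : Finset G)) (f := f) (fun x _ => Finset.mem_univ (f x))
    rw [Finset.card_univ, Fintype.card_fin] at this
    refine this.trans (Finset.sum_congr rfl fun a _ => ?_)
    unfold fiber
    congr!
  have h2 := Finset.add_sum_erase Finset.univ (fun a => (fiber f a).card) (Finset.mem_univ (0 : G))
  rw [Finset.sum_congr rfl (fun a ha => hf a (Finset.ne_of_mem_erase ha)), Finset.sum_const,
    Finset.card_erase_of_mem (Finset.mem_univ _), Finset.card_univ, smul_eq_mul] at h2
  exact h2.trans h1.symm

theorem exists_boxProp_imp_hasNearDecomposition {γ : ℝ} (hγ : 0 < γ) :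
    ∃ lam tau : ℝ, 0 < lam ∧ 0 < tau ∧ ∃ n₀ : ℕ, ∀ n ≥ n₀, ∀ H : Fin n → Fin n → Fin n → Bool,
      BoxProp lam tau H → BoxProp lam tau (fun j i k => H i j k) →
      BoxProp lam tau (fun k i j => H i j k) → HasNearDecomposition γ H := by
  obtain ⟨q, hq⟩ := exists_nat_ge (100 / γ)
  rw [div_le_iff₀ hγ] at hq
  set m : ℕ := q + 2 with hm
  have hm2 : (2 : ℝ) ≤ m := by
    rw [hm]
    push_cast
    linarith [Nat.cast_nonneg (α := ℝ) q]
  have hγm : 100 ≤ γ * m := by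
    rw [hm]
    push_cast
    linarith
  have hm0 : (0 : ℝ) < m := by linarith
  refine ⟨1 / (4 * m ^ 2), 1 / (16 * m ^ 4), by positivity, by positivity, 100 * m ^ 3, ?_⟩
  intro n hn H hH hH' hH''
  have hn' : (100 : ℝ) * m ^ 3 ≤ n := by exact_mod_cast hn
  obtain ⟨x, hx⟩ : ∃ x : ℝ, (n : ℝ) = m ^ 2 * x := ⟨n / m ^ 2, by field_simp⟩
  have hxm : 100 * m ≤ x := by
    have : (m : ℝ) ^ 2 * (100 * m) ≤ m ^ 2 * x := by linarith
    exact le_of_mul_le_mul_left this (by positivity)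
  have hx0 : 0 < x := by linarith
  have hmx : 2 * x ≤ m * x := mul_le_mul_of_nonneg_right hm2 hx0.le
  have hcard : Fintype.card (ZMod m) = m := ZMod.card m
  have hm1 : ((m - 1 : ℕ) : ℝ) = m - 1 := by
    rw [Nat.cast_sub (by omega)]
    simp
  have hm1pos : 0 < m - 1 := by omega
  have hm1pos' : (0 : ℝ) < m - 1 := by linarith
  set s : ℕ := n / (m - 1) with hs
  set w : ℕ := n / m with hw
  have hs1 : (m - 1) * s ≤ n := Nat.mul_div_le n (m - 1)
  have hs2 : n < (m - 1) * (s + 1) := Nat.lt_mul_div_succ n hm1pos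
  have hw1 : m * w ≤ n := Nat.mul_div_le n m
  have hw2 : n < m * (w + 1) := Nat.lt_mul_div_succ n (by omega)
  obtain ⟨ρ, hρ⟩ := exists_card_fiber_eq (n := n) (s := w) (ZMod m) (by
    rw [hcard]
    exact (Nat.mul_le_mul_right _ (Nat.sub_le _ _)).trans hw1)
  obtain ⟨κ, hκ⟩ := exists_card_fiber_eq (n := n) (s := s) (ZMod m) (by rwa [hcard])
  have hρ0 := card_fiber_zero_add hρ
  have hκ0 := card_fiber_zero_add hκ
  rw [hcard] at hρ0 hκ0
  have hρ0' : ((fiber ρ 0).card : ℝ) + (m - 1) * w = n := by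
    rw [← hm1]
    exact_mod_cast hρ0
  have hs1' : ((m : ℝ) - 1) * s ≤ m ^ 2 * x := by
    rw [← hm1, ← hx]
    exact_mod_cast hs1
  have hs2' : (m : ℝ) ^ 2 * x < (m - 1) * (s + 1) := by
    rw [← hm1, ← hx]
    exact_mod_cast hs2
  have hw1' : (m : ℝ) * w ≤ m * (m * x) := by
    rw [← mul_assoc, ← sq, ← hx]
    exact_mod_cast hw1
  have hw2' : (m : ℝ) * (m * x) < m * (w + 1) := by
    rw [← mul_assoc, ← sq, ← hx]
    exact_mod_cast hw2
  have hwle : (w : ℝ) ≤ m * x := le_of_mul_le_mul_left hw1' hm0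
  have hwge : m * x < w + 1 := lt_of_mul_lt_mul_left hw2' hm0.le
  have hsle : (s : ℝ) ≤ 2 * (m * x) := by
    refine le_of_mul_le_mul_left (hs1'.trans ?_) hm1pos'
    nlinarith
  have hsge : m * x + x < s + 1 := by
    refine lt_of_mul_lt_mul_left (lt_of_le_of_lt ?_ hs2') hm1pos'.le
    nlinarith
  have hlamn : 1 / (4 * (m : ℝ) ^ 2) * n = x / 4 := by
    rw [hx]
    field_simp
  have htaun : m * (1 / (16 * (m : ℝ) ^ 4)) * n = x / (16 * m) := by
    rw [hx]
    field_simp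
  have hγn : 100 * (m * x) ≤ γ * n := by
    have := mul_le_mul_of_nonneg_right hγm (by positivity : 0 ≤ (m : ℝ) * x)
    rw [hx]
    linarith
  have hxx : x / (16 * m) ≤ x := div_le_self hx0.le (by linarith)
  refine hasNearDecomposition_of_boxProp (m := m) (b := x / 8) (δ := γ / 2 * n - s)
    (by positivity) (by positivity) hcard ρ κ hH hH' hH'' hκ ?_ hρ ?_ ?_ ?_ ?_ ?_ ?_ ?_
  · rw [Nat.mul_succ] at hs2
    omega
  · intro r
    rw [hlamn]
    by_cases hr : r = 0
    · rw [hr]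
      have : ((m : ℝ) - 1) * (m * x) ≤ (m - 1) * (w + 1) :=
        mul_le_mul_of_nonneg_left hwge.le hm1pos'.le
      rw [hx] at hρ0'
      linarith
    · rw [hρ r hr]
      linarith
  · linarith
  · linarith
  · rw [htaun]
    have h1 : (n : ℝ) * (x / (16 * m)) = x / 16 * (m * x) := by
      rw [hx]
      field_simp
    rw [h1]
    have h2 : x / 16 ≤ x / 8 - m := by linarith
    exact mul_le_mul h2 (by linarith) (by positivity) (by linarith)
  · rw [hlamn]
    linarith
  · linarith
  · rw [htaun]
    linarith

lemma arrWeight_nonneg {n : ℕ} {p : ℝ} (hp0 : 0 ≤ p) (hp1 : p ≤ 1)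
    (H : Fin n → Fin n → Fin n → Bool) : 0 ≤ ∏ i, matWeight p (H i) :=
  Finset.prod_nonneg fun _ _ => matWeight_nonneg hp0 hp1 _

lemma sum_arrWeight {n : ℕ} {p : ℝ} :
    ∑ H : Fin n → Fin n → Fin n → Bool, ∏ i, matWeight p (H i) = 1 := by
  rw [← Fintype.prod_sum (fun (_ : Fin n) x => matWeight p x)]
  simp [sum_matWeight]

lemma arrProb_comp_swap_fst_snd {n : ℕ} {p : ℝ} (P : (Fin n → Fin n → Fin n → Bool) → Prop) :
    arrProb n n n p (fun H => P (fun j i k => H i j k)) = arrProb n n n p P := by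
  refine Fintype.sum_equiv (Equiv.piComm fun _ _ => Fin n → Bool) _ _ fun H => ?_
  have : (∏ i, ∏ j, ∏ c, if H i j c = true then p else 1 - p) =
      ∏ j, ∏ i, ∏ c, if H i j c = true then p else 1 - p := Finset.prod_comm
  rw [this]
  rfl

lemma arrProb_comp_swap_snd_trd {n : ℕ} {p : ℝ} (P : (Fin n → Fin n → Fin n → Bool) → Prop) :
    arrProb n n n p (fun H => P (fun i k j => H i j k)) = arrProb n n n p P := by
  refine Fintype.sum_equiv (Equiv.piCongrRight fun _ => Equiv.piComm fun _ _ => Bool) _ _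
    fun H => ?_
  have : (∏ i, ∏ j, ∏ c, if H i j c = true then p else 1 - p) =
      ∏ i, ∏ c, ∏ j, if H i j c = true then p else 1 - p :=
    Finset.prod_congr rfl fun i _ => Finset.prod_comm
  rw [this]
  rfl

lemma arrProb_comp_rotate {n : ℕ} {p : ℝ} (P : (Fin n → Fin n → Fin n → Bool) → Prop) :
    arrProb n n n p (fun H => P (fun k i j => H i j k)) = arrProb n n n p P := by
  rw [← arrProb_comp_swap_fst_snd P,
    ← arrProb_comp_swap_snd_trd (fun H => P (fun j i k => H i j k))]

/-- The failure probability of the uniform box property. -/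
lemma arrProb_not_boxProp_le {n : ℕ} (hn : 0 < n) {p lam tau : ℝ} (hp0 : 0 ≤ p) (hp1 : p ≤ 1)
    (hlam : 0 < lam) (htau : 0 < tau) :
    arrProb n n n p (fun H => ¬ BoxProp lam tau H) ≤
      8 ^ n * (n * (4 ^ n * Real.exp (-(p * (lam * tau * n ^ 2 * Real.exp (-(1 / lam))))))) := by
  have hn' : (0 : ℝ) < n := by exact_mod_cast hn
  set d : ℝ := lam * n with hd
  set c : ℝ := lam * tau * n ^ 2 * Real.exp (-(1 / lam)) with hc
  have hd0 : 0 < d := by positivity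
  have hc0 : 0 ≤ c := by positivity
  set B := (Finset.univ : Finset (Finset (Fin n) × Finset (Fin n) × Finset (Fin n))).filter
    (fun b => b.2.1.card = b.2.2.card ∧ (b.1.card : ℝ) + d ≤ b.2.1.card) with hB
  have hW := arrWeight_nonneg (n := n) hp0 hp1
  have hBcard : (B.card : ℝ) ≤ 8 ^ n := by
    have h1 : B.card ≤ 8 ^ n := by
      refine (Finset.card_le_univ _).trans (le_of_eq ?_)
      simp only [Fintype.card_prod, Fintype.card_finset, Fintype.card_fin]
      rw [← mul_pow, ← mul_pow]
      norm_num
    exact_mod_cast h1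
  calc arrProb n n n p (fun H => ¬ BoxProp lam tau H)
      ≤ weightProb (fun H : Fin n → Fin n → Fin n → Bool => ∏ i, matWeight p (H i))
        (fun H => ∃ b ∈ B, ¬ BoxGood c d b.1 b.2.1 b.2.2 H) := by
        refine weightProb_mono hW fun H hH => ?_
        by_contra hcon
        push Not at hcon
        refine hH fun I L R hLR hIL => ?_
        obtain ⟨S, h1, h2, -, h3⟩ := hcon (I, L, R) (by simpa [hB] using ⟨hLR, hIL⟩)
        refine ⟨S, h1, h2, fun i hi => ?_⟩
        have h4 : (1 + 1 / d) ^ I.card ≤ Real.exp (1 / lam) := by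
          have hIn : (I.card : ℝ) ≤ n := by
            have := Finset.card_le_univ I
            rw [Fintype.card_fin] at this
            exact_mod_cast this
          calc (1 + 1 / d) ^ I.card ≤ Real.exp (1 / d) ^ I.card := by
                refine pow_le_pow_left₀ (by positivity) ?_ _
                rw [add_comm]
                exact Real.add_one_le_exp _
            _ = Real.exp (I.card * (1 / d)) := (Real.exp_nat_mul _ _).symm
            _ ≤ Real.exp (1 / lam) := by
                refine Real.exp_le_exp.2 ?_
                rw [mul_one_div, div_le_div_iff₀ hd0 hlam, hd]
                nlinarith
        have h5 : c * (1 + 1 / d) ^ I.card ≤ d * (tau * n) := by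
          calc c * (1 + 1 / d) ^ I.card ≤ c * Real.exp (1 / lam) :=
                mul_le_mul_of_nonneg_left h4 hc0
            _ = lam * tau * n ^ 2 * (Real.exp (-(1 / lam)) * Real.exp (1 / lam)) := by
                rw [hc]
                ring
            _ = d * (tau * n) := by
                rw [← Real.exp_add, neg_add_cancel, Real.exp_zero, hd]
                ring
        have := le_of_mul_le_mul_left ((h3 i hi).trans h5) hd0
        linarith
    _ ≤ ∑ b ∈ B, weightProb (fun H : Fin n → Fin n → Fin n → Bool => ∏ i, matWeight p (H i))
        (fun H => ¬ BoxGood c d b.1 b.2.1 b.2.2 H) := weightProb_exists_le hW _ _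
    _ ≤ ∑ b ∈ B, (n * (4 ^ n * Real.exp (-(p * c)))) := by
        refine Finset.sum_le_sum fun b hb => ?_
        obtain ⟨-, h1, h2⟩ := Finset.mem_filter.1 hb
        refine (weightProb_not_boxGood_le hp0 hp1 hc0 hd0 h1 b.1 h2).trans ?_
        refine mul_le_mul_of_nonneg_right ?_ (by positivity)
        have := Finset.card_le_univ b.1
        rw [Fintype.card_fin] at this
        exact_mod_cast this
    _ = B.card * (n * (4 ^ n * Real.exp (-(p * c)))) := by
        rw [Finset.sum_const, nsmul_eq_mul]
    _ ≤ _ := mul_le_mul_of_nonneg_right hBcard (by positivity)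

lemma tendsto_arrProb_not_boxProp {p : ℕ → ℝ} (hp0 : ∀ n, 0 ≤ p n) (hp1 : ∀ n, p n ≤ 1)
    (hp : Filter.Tendsto (fun n : ℕ => p n * n) Filter.atTop Filter.atTop) {lam tau : ℝ}
    (hlam : 0 < lam) (htau : 0 < tau) :
    Filter.Tendsto (fun n : ℕ => arrProb n n n (p n) (fun H => ¬ BoxProp lam tau H))
      Filter.atTop (nhds 0) := by
  set ε : ℝ := lam * tau * Real.exp (-(1 / lam)) with hε
  have hε0 : 0 < ε := by positivity
  have hexp : Filter.Tendsto (fun n : ℕ => Real.exp (-(n : ℝ))) Filter.atTop (nhds 0) :=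
    Real.tendsto_exp_neg_atTop_nhds_zero.comp tendsto_natCast_atTop_atTop
  refine tendsto_of_tendsto_of_tendsto_of_le_of_le' tendsto_const_nhds hexp
    (Filter.Eventually.of_forall fun n =>
      weightProb_nonneg (arrWeight_nonneg (hp0 n) (hp1 n)) _) ?_
  filter_upwards [hp.eventually_ge_atTop ((Real.log 32 + 2) / ε), Filter.eventually_gt_atTop 0]
    with n hn hn0
  refine (arrProb_not_boxProp_le hn0 (hp0 n) (hp1 n) hlam htau).trans ?_
  rw [div_le_iff₀ hε0] at hn
  have h1 : (n : ℝ) ≤ Real.exp n := by linarith [Real.add_one_le_exp (n : ℝ)]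
  have h2 : (8 : ℝ) ^ n * 4 ^ n = Real.exp (n * Real.log 32) := by
    rw [Real.exp_nat_mul, Real.exp_log (by norm_num), ← mul_pow]
    norm_num
  calc (8 : ℝ) ^ n * (n * (4 ^ n *
        Real.exp (-(p n * (lam * tau * n ^ 2 * Real.exp (-(1 / lam)))))))
      = (8 ^ n * 4 ^ n) * n * Real.exp (-(n * (p n * n * ε))) := by
        rw [hε, show p n * (lam * tau * n ^ 2 * Real.exp (-(1 / lam))) =
          n * (p n * n * (lam * tau * Real.exp (-(1 / lam)))) by ring]
        ring
    _ ≤ Real.exp (n * Real.log 32) * Real.exp n * Real.exp (-(n * (Real.log 32 + 2))) := by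
        rw [h2]
        gcongr
    _ = Real.exp (-n) := by
        rw [← Real.exp_add, ← Real.exp_add]
        congr 1
        ring

/-- If `p·n → ∞` and `H ~ H₃(n;p)` (each of the `n³` triangles present independently
with probability `p`), then for every `γ > 0`, w.h.p. the triangles of `H` contain a set
`S` of edge-disjoint triangles with `d_S(v) ≥ (1−γ)n` for every vertex `v`. -/
theorem stmt14 (p : ℕ → ℝ) (hp0 : ∀ n, 0 ≤ p n) (hp1 : ∀ n, p n ≤ 1)
    (hp : Filter.Tendsto (fun n : ℕ => p n * n) Filter.atTop Filter.atTop)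
    (γ : ℝ) (hγ : 0 < γ) :
    Filter.Tendsto (fun n : ℕ =>
      arrProb n n n (p n) (fun H => ∃ S : Finset (Fin n × Fin n × Fin n),
        (∀ t ∈ S, H t.1 t.2.1 t.2.2 = true) ∧ EdgeDisjointSet S ∧
        (∀ v : Fin n,
          (1 - γ) * n ≤ ((S.filter (fun t => t.1 = v)).card : ℝ) ∧
          (1 - γ) * n ≤ ((S.filter (fun t => t.2.1 = v)).card : ℝ) ∧
          (1 - γ) * n ≤ ((S.filter (fun t => t.2.2 = v)).card : ℝ))))
      Filter.atTop (nhds 1) := by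
  obtain ⟨lam, tau, hlam, htau, n₀, hn₀⟩ := exists_boxProp_imp_hasNearDecomposition hγ
  have hlim := (tendsto_arrProb_not_boxProp hp0 hp1 hp hlam htau).const_mul 3
  have hlow := tendsto_const_nhds (x := (1 : ℝ)).sub hlim
  rw [mul_zero, sub_zero] at hlow
  refine tendsto_of_tendsto_of_tendsto_of_le_of_le' hlow tendsto_const_nhds ?_ ?_
  · filter_upwards [Filter.eventually_ge_atTop n₀] with n hn
    have hW := arrWeight_nonneg (n := n) (hp0 n) (hp1 n)
    have h1 := weightProb_not (sum_arrWeight (n := n) (p := p n)) (HasNearDecomposition γ)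
    have h2 : weightProb (fun H : Fin n → Fin n → Fin n → Bool => ∏ i, matWeight (p n) (H i))
        (fun H => ¬ HasNearDecomposition γ H) ≤
        arrProb n n n (p n) (fun H => ¬ BoxProp lam tau H) +
        (arrProb n n n (p n) (fun H => ¬ BoxProp lam tau (fun j i k => H i j k)) +
        arrProb n n n (p n) (fun H => ¬ BoxProp lam tau (fun k i j => H i j k))) := by
      refine le_trans ?_ ((weightProb_or_le hW _ _).trans
        (add_le_add le_rfl (weightProb_or_le hW _ _)))
      refine weightProb_mono hW fun H hH => ?_
      by_contra hcon
      push Not at hcon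
      exact hH (hn₀ n hn H hcon.1 hcon.2.1 hcon.2.2)
    rw [arrProb_comp_swap_fst_snd (fun H => ¬ BoxProp lam tau H),
      arrProb_comp_rotate (fun H => ¬ BoxProp lam tau H)] at h2
    change _ ≤ weightProb (fun H : Fin n → Fin n → Fin n → Bool => ∏ i, matWeight (p n) (H i))
      (HasNearDecomposition γ)
    linarith
  · refine Filter.Eventually.of_forall fun n => ?_
    have hW := arrWeight_nonneg (n := n) (hp0 n) (hp1 n)
    have h1 := weightProb_not (sum_arrWeight (n := n) (p := p n)) (HasNearDecomposition γ)
    have h2 := weightProb_nonneg hW (fun H => ¬ HasNearDecomposition γ H)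
    change weightProb (fun H : Fin n → Fin n → Fin n → Bool => ∏ i, matWeight (p n) (H i))
      (HasNearDecomposition γ) ≤ _
    linarith

end
end

section
/- Consider a uniformly random ordering t_1, t_2, …, t_{n³} of the triangles of the complete tripartite 3-uniform hypergraph on [n]⊔[n]⊔[n], and define S_0 = ∅ and S_{i+1} = S_i ∪ {t_{i+1}} if t_{i+1} is edge-disjoint from S_i, and S_{i+1} = S_i otherwise. Then there exists δ > 0 such that for every η > 0 and every C > 0, for all sufficiently large n, with probability at least 1 − n^{−C} the following holds for every vertex v and every integer 0 ≤ m ≤ n^{2+δ}: d_{S_m}(v) = (1 − (1±η)/√(1+2m/n²))·n, i.e., |n − d_{S_m}(v) − n/√(1+2m/n²)| ≤ η·n/√(1+2m/n²). -/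
attribute [local instance] Classical.propDecidable

noncomputable section

/-- Two tripartite triangles share (at least) two vertices, i.e. agree in at least two
coordinates. -/
def Shares2 {n : ℕ} (t t' : Fin n × Fin n × Fin n) : Prop :=
  (t.1 = t'.1 ∧ t.2.1 = t'.2.1) ∨ (t.1 = t'.1 ∧ t.2.2 = t'.2.2) ∨
  (t.2.1 = t'.2.1 ∧ t.2.2 = t'.2.2)

/-- The greedy set-of-edge-disjoint-triangles process along the ordering `σ` of the `n³`
triangles: `S_0 = ∅`, and `t_{i+1} = σ i` is added to `S_i` iff it is edge-disjoint from
`S_i`. -/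
def greedySet (n : ℕ) (σ : Fin (n ^ 3) ≃ (Fin n × Fin n × Fin n)) :
    ℕ → Finset (Fin n × Fin n × Fin n)
  | 0 => ∅
  | (i + 1) =>
    let S := greedySet n σ i
    if h : i < n ^ 3 then
      if ∀ t' ∈ S, ¬ Shares2 (σ ⟨i, h⟩) t' then insert (σ ⟨i, h⟩) S else S
    else S

/-! ### Concentration for adapted counting processes along a uniformly random ordering -/

section Ordering

variable {N : ℕ} {T : Type*}

/-- A family of finite sets attached to an ordering and a time that depends only on the entries
before that time, and contains none of them. -/
structure IsFreshAdapted (K : (Fin N ≃ T) → ℕ → Finset T) : Prop where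
  adapted : ∀ σ σ' i, (∀ j : Fin N, (j : ℕ) < i → σ j = σ' j) → K σ i = K σ' i
  fresh : ∀ σ i (j : Fin N), (j : ℕ) < i → σ j ∉ K σ i

/-- The number of times `j < i` at which the entry of the ordering lies in the set `K σ j`. -/
def hits (K : (Fin N ≃ T) → ℕ → Finset T) (σ : Fin N ≃ T) (i : ℕ) : ℝ :=
  ∑ j ∈ Finset.range i, if ∃ h : j < N, σ ⟨j, h⟩ ∈ K σ j then 1 else 0

/-- The compensator of `hits`. -/
def compensator (K : (Fin N ≃ T) → ℕ → Finset T) (σ : Fin N ≃ T) (i : ℕ) : ℝ :=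
  ∑ j ∈ Finset.range i, ((K σ j).card : ℝ) / ((N : ℝ) - j)

lemma hits_congr {K : (Fin N ≃ T) → ℕ → Finset T} (hK : IsFreshAdapted K)
    {σ σ' : Fin N ≃ T} {i : ℕ} (h : ∀ j : Fin N, (j : ℕ) < i → σ j = σ' j) :
    hits K σ i = hits K σ' i := by
  refine Finset.sum_congr rfl fun j hj => ?_
  have hj' := Finset.mem_range.1 hj
  rw [hK.adapted σ σ' j fun l hl => h l (hl.trans hj')]
  have : (∃ h : j < N, σ ⟨j, h⟩ ∈ K σ' j) ↔ (∃ h : j < N, σ' ⟨j, h⟩ ∈ K σ' j) :=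
    exists_congr fun hN => by rw [h ⟨j, hN⟩ hj']
  simp only [this]

lemma compensator_congr {K : (Fin N ≃ T) → ℕ → Finset T} (hK : IsFreshAdapted K)
    {σ σ' : Fin N ≃ T} {i : ℕ} (h : ∀ j : Fin N, (j : ℕ) < i → σ j = σ' j) :
    compensator K σ i = compensator K σ' i := by
  refine Finset.sum_congr rfl fun j hj => ?_
  rw [hK.adapted σ σ' j fun l hl => h l (hl.trans (Finset.mem_range.1 hj))]

/-- Conditionally on its first `i` entries, the next entry of a uniformly random ordering is
uniform among the remaining ones. -/
lemma sum_apply_eq_sum_average [Fintype T] {i : ℕ} (hi : i < N)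
    (f : (Fin N ≃ T) → T → ℝ)
    (hf : ∀ σ σ' : Fin N ≃ T, (∀ j : Fin N, (j : ℕ) < i → σ j = σ' j) → f σ = f σ') :
    ((N : ℝ) - i) * ∑ σ, f σ (σ ⟨i, hi⟩) = ∑ σ, ∑ j ∈ Finset.Ici (⟨i, hi⟩ : Fin N), f σ (σ j) := by
  rw [Finset.sum_comm]
  have key : ∀ j ∈ Finset.Ici (⟨i, hi⟩ : Fin N),
      ∑ σ, f σ (σ j) = ∑ σ, f σ (σ ⟨i, hi⟩) := by
    intro j hj
    have hij : (⟨i, hi⟩ : Fin N) ≤ j := Finset.mem_Ici.1 hj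
    rw [Fin.le_def] at hij
    refine Fintype.sum_equiv
      ((Equiv.swap (⟨i, hi⟩ : Fin N) j).equivCongr (Equiv.refl T)) _ _ fun σ => ?_
    have h1 : f σ = f ((Equiv.swap (⟨i, hi⟩ : Fin N) j).equivCongr (Equiv.refl T) σ) := by
      refine hf _ _ fun l hl => ?_
      have h2 : l ≠ ⟨i, hi⟩ := fun h => by subst h; exact lt_irrefl _ hl
      have h3 : l ≠ j := fun h => by subst h; exact absurd hij hl.not_ge
      simp [Equiv.equivCongr, Equiv.swap_apply_of_ne_of_ne h2 h3]
    rw [← h1]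
    simp [Equiv.equivCongr]
  rw [Finset.sum_congr rfl key, Finset.sum_const, nsmul_eq_mul, Fin.card_Ici,
    Nat.cast_sub hi.le]

lemma exp_mul_one_add_le {s p : ℝ} (hs : |s| ≤ 1) (hp : 0 ≤ p) :
    Real.exp (-(s * p)) * (1 + (Real.exp s - 1) * p) ≤ Real.exp (s ^ 2 * p) := by
  have h1 := (abs_le.1 (Real.abs_exp_sub_one_sub_id_le hs)).2
  calc Real.exp (-(s * p)) * (1 + (Real.exp s - 1) * p)
      ≤ Real.exp (-(s * p)) * Real.exp ((Real.exp s - 1) * p) := by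
        gcongr; linarith [Real.add_one_le_exp ((Real.exp s - 1) * p)]
    _ = Real.exp ((Real.exp s - 1 - s) * p) := by rw [← Real.exp_add]; congr 1; ring
    _ ≤ _ := Real.exp_le_exp.2 (mul_le_mul_of_nonneg_right h1 hp)

lemma sum_exp_fresh {K : (Fin N ≃ T) → ℕ → Finset T} (hK : IsFreshAdapted K) {i : ℕ} (hi : i < N)
    (σ : Fin N ≃ T) (s : ℝ) :
    ∑ j ∈ Finset.Ici (⟨i, hi⟩ : Fin N), Real.exp (s * if σ j ∈ K σ i then 1 else 0) =
      ((N : ℝ) - i) + (Real.exp s - 1) * (K σ i).card := by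
  have h1 : ∀ j : Fin N, Real.exp (s * if σ j ∈ K σ i then 1 else 0) =
      1 + (Real.exp s - 1) * if σ j ∈ K σ i then 1 else 0 := by
    intro j; split_ifs <;> simp
  have h2 : (Finset.filter (fun j => σ j ∈ K σ i) (Finset.Ici (⟨i, hi⟩ : Fin N))).card =
      (K σ i).card := by
    refine Finset.card_bij (fun j _ => σ j) (fun j hj => (Finset.mem_filter.1 hj).2)
      (fun _ _ _ _ h => σ.injective h) fun t ht => ⟨σ.symm t, ?_, by simp⟩
    refine Finset.mem_filter.2 ⟨Finset.mem_Ici.2 ?_, by simpa using ht⟩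
    by_contra! hlt
    exact hK.fresh σ i (σ.symm t) hlt (by simpa using ht)
  simp only [h1, Finset.sum_add_distrib, ← Finset.mul_sum, Finset.sum_boole, h2]
  simp [Fin.card_Ici, Nat.cast_sub hi.le]

lemma sum_exp_hits_sub_compensator_le [Fintype T] {K : (Fin N ≃ T) → ℕ → Finset T}
    (hK : IsFreshAdapted K)
    {s p : ℝ} (hs : |s| ≤ 1) {i : ℕ} (hi : i ≤ N)
    (hp : ∀ σ, ∀ j < i, ((K σ j).card : ℝ) / ((N : ℝ) - j) ≤ p) :
    ∑ σ, Real.exp (s * (hits K σ i - compensator K σ i)) ≤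
      Fintype.card (Fin N ≃ T) * Real.exp (i * (s ^ 2 * p)) := by
  induction i with
  | zero => simp [hits, compensator]
  | succ i ih =>
    have hi' : i < N := hi
    have hpos : (0 : ℝ) < (N : ℝ) - i := sub_pos.2 (by exact_mod_cast hi')
    set g : (Fin N ≃ T) → ℝ := fun σ => Real.exp (s * (hits K σ i - compensator K σ i)) with hg
    set q : (Fin N ≃ T) → ℝ := fun σ => ((K σ i).card : ℝ) / ((N : ℝ) - i) with hq
    have hstep : ∀ σ : Fin N ≃ T, Real.exp (s * (hits K σ (i + 1) - compensator K σ (i + 1))) =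
        g σ * Real.exp (-(s * q σ)) * Real.exp (s * if σ ⟨i, hi'⟩ ∈ K σ i then 1 else 0) := by
      intro σ
      simp only [hg, hq, ← Real.exp_add, hits, compensator, Finset.sum_range_succ, hi',
        exists_true_left]
      congr 1; ring
    have havg := sum_apply_eq_sum_average hi'
      (fun σ t => g σ * Real.exp (-(s * q σ)) * Real.exp (s * if t ∈ K σ i then 1 else 0))
      (fun σ σ' h => by
        simp only [hg, hq, hits_congr hK h, compensator_congr hK h, hK.adapted σ σ' i h])
    have hle : ∀ σ, g σ * Real.exp (-(s * q σ)) *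
        (((N : ℝ) - i) + (Real.exp s - 1) * (K σ i).card) ≤
          ((N : ℝ) - i) * (Real.exp (s ^ 2 * p) * g σ) := by
      intro σ
      have h1 : ((N : ℝ) - i) + (Real.exp s - 1) * (K σ i).card =
          ((N : ℝ) - i) * (1 + (Real.exp s - 1) * q σ) := by
        simp only [hq]; field_simp
      have h2 := exp_mul_one_add_le hs (p := q σ) (by positivity)
      have h3 : Real.exp (s ^ 2 * q σ) ≤ Real.exp (s ^ 2 * p) := by
        have := hp σ i (Nat.lt_succ_self i)
        gcongr
      rw [h1]
      have hg0 : 0 ≤ g σ := (Real.exp_pos _).le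
      calc _ = ((N : ℝ) - i) * (g σ * (Real.exp (-(s * q σ)) * (1 + (Real.exp s - 1) * q σ))) := by
            ring
        _ ≤ ((N : ℝ) - i) * (g σ * Real.exp (s ^ 2 * p)) := by
            gcongr; exact h2.trans h3
        _ = _ := by ring
    have hmain : ((N : ℝ) - i) * ∑ σ, Real.exp (s * (hits K σ (i + 1) - compensator K σ (i + 1))) ≤
        ((N : ℝ) - i) * (Real.exp (s ^ 2 * p) * ∑ σ, g σ) := by
      simp only [hstep]
      rw [havg, Finset.mul_sum, Finset.mul_sum]
      refine Finset.sum_le_sum fun σ _ => ?_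
      rw [← Finset.mul_sum, sum_exp_fresh hK hi' σ s]
      exact hle σ
    have hih := ih hi'.le fun σ j hj => hp σ j (hj.trans (Nat.lt_succ_self i))
    calc _ ≤ Real.exp (s ^ 2 * p) * ∑ σ, g σ := le_of_mul_le_mul_left hmain hpos
      _ ≤ Real.exp (s ^ 2 * p) *
          (Fintype.card (Fin N ≃ T) * Real.exp (i * (s ^ 2 * p))) := by gcongr
      _ = _ := by
        rw [mul_left_comm, ← Real.exp_add]; congr 2; push_cast; ring

/-- Bernstein-type tail bound for `hits`. -/
lemma card_hits_deviation_le [Fintype T] [DecidableEq T] {K : (Fin N ≃ T) → ℕ → Finset T}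
    (hK : IsFreshAdapted K)
    {s p E : ℝ} (hs0 : 0 ≤ s) (hs : s ≤ 1) {i : ℕ} (hi : i ≤ N)
    (hp : ∀ σ, ∀ j < i, ((K σ j).card : ℝ) / ((N : ℝ) - j) ≤ p) :
    ((Finset.univ.filter fun σ : Fin N ≃ T => E < |hits K σ i - compensator K σ i|).card : ℝ) ≤
      Fintype.card (Fin N ≃ T) * (2 * Real.exp (i * (s ^ 2 * p) - s * E)) := by
  obtain rfl : ‹DecidableEq T› = fun a b => Classical.propDecidable (a = b) :=
    Subsingleton.elim _ _
  have h1 := sum_exp_hits_sub_compensator_le hK (s := s) (abs_le.2 ⟨by linarith, hs⟩) hi hp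
  have h2 := sum_exp_hits_sub_compensator_le hK (s := -s) (abs_le.2 ⟨by linarith, by linarith⟩)
    hi hp
  rw [neg_sq] at h2
  have h3 : ((Finset.univ.filter fun σ : Fin N ≃ T =>
      E < |hits K σ i - compensator K σ i|).card : ℝ) * Real.exp (s * E) ≤
      ∑ σ, Real.exp (s * (hits K σ i - compensator K σ i)) +
        ∑ σ, Real.exp (-s * (hits K σ i - compensator K σ i)) := by
    rw [← Finset.sum_add_distrib, ← nsmul_eq_mul]
    refine (Finset.card_nsmul_le_sum _ _ _ fun σ hσ => ?_).trans
      (Finset.sum_le_sum_of_subset_of_nonneg (Finset.subset_univ _) fun _ _ _ => by positivity)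
    have hE := (Finset.mem_filter.1 hσ).2
    rcases lt_abs.1 hE with h | h
    · have : Real.exp (s * E) ≤ Real.exp (s * (hits K σ i - compensator K σ i)) := by gcongr
      linarith [Real.exp_pos (-s * (hits K σ i - compensator K σ i))]
    · have : Real.exp (s * E) ≤ Real.exp (-s * (hits K σ i - compensator K σ i)) := by
        rw [neg_mul, ← mul_neg]; gcongr
      linarith [Real.exp_pos (s * (hits K σ i - compensator K σ i))]
  rw [Real.exp_sub, mul_div_assoc', mul_div_assoc', le_div_iff₀ (Real.exp_pos _)]
  linarith

end Ordering

/-! ### Combinatorics of the greedy process -/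

section Greedy

variable {n : ℕ}

/-- The vertex of a tripartite triangle in the part `k`. -/
def coord (k : Fin 3) (t : Fin n × Fin n × Fin n) : Fin n := ![t.1, t.2.1, t.2.2] k

lemma shares2_iff {k l m : Fin 3} (hkl : k ≠ l) (hkm : k ≠ m) (hlm : l ≠ m)
    (t t' : Fin n × Fin n × Fin n) :
    Shares2 t t' ↔ (coord k t = coord k t' ∧ coord l t = coord l t') ∨
      (coord k t = coord k t' ∧ coord m t = coord m t') ∨
      (coord l t = coord l t' ∧ coord m t = coord m t') := by
  fin_cases k <;> fin_cases l <;> fin_cases m <;> simp [Shares2, coord] at * <;> tauto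

lemma coord_ext {k l m : Fin 3} (hkl : k ≠ l) (hkm : k ≠ m) (hlm : l ≠ m)
    {t t' : Fin n × Fin n × Fin n} (h1 : coord k t = coord k t') (h2 : coord l t = coord l t')
    (h3 : coord m t = coord m t') : t = t' := by
  obtain ⟨a, b, c⟩ := t
  obtain ⟨a', b', c'⟩ := t'
  fin_cases k <;> fin_cases l <;> fin_cases m <;> simp [coord] at * <;> tauto

lemma exists_coord {k l m : Fin 3} (hkl : k ≠ l) (hkm : k ≠ m) (hlm : l ≠ m) (a b c : Fin n) :
    ∃ t : Fin n × Fin n × Fin n, coord k t = a ∧ coord l t = b ∧ coord m t = c := by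
  refine ⟨(if k = 0 then a else if l = 0 then b else c,
    if k = 1 then a else if l = 1 then b else c, if k = 2 then a else if l = 2 then b else c), ?_⟩
  fin_cases k <;> fin_cases l <;> fin_cases m <;> simp [coord] at *

lemma card_filter_coord_eq (k : Fin 3) (a : Fin n) :
    (Finset.univ.filter fun t : Fin n × Fin n × Fin n => coord k t = a).card = n ^ 2 := by
  have h : ∀ l m : Fin 3, k ≠ l → k ≠ m → l ≠ m →
      (Finset.univ.filter fun t : Fin n × Fin n × Fin n => coord k t = a).card = n ^ 2 := by
    intro l m hkl hkm hlm
    have : (Finset.univ : Finset (Fin n × Fin n)).card = n ^ 2 := by simp [sq]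
    rw [← this]
    refine Finset.card_bij (fun t _ => (coord l t, coord m t)) (fun _ _ => Finset.mem_univ _) ?_ ?_
    · intro t ht t' ht' heq
      simp only [Finset.mem_filter, Finset.mem_univ, true_and, Prod.mk.injEq] at ht ht' heq
      exact coord_ext hkl hkm hlm (ht.trans ht'.symm) heq.1 heq.2
    · rintro ⟨b, c⟩ -
      obtain ⟨t, h1, h2, h3⟩ := exists_coord hkl hkm hlm a b c
      exact ⟨t, by simpa using h1, by simp [h2, h3]⟩
  fin_cases k
  · exact h 1 2 (by simp) (by simp) (by simp)
  · exact h 0 2 (by simp) (by simp) (by simp)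
  · exact h 0 1 (by simp) (by simp) (by simp)

/-- The triangles that are edge-disjoint from `S`. -/
def available (S : Finset (Fin n × Fin n × Fin n)) : Finset (Fin n × Fin n × Fin n) :=
  Finset.univ.filter fun t => ∀ t' ∈ S, ¬ Shares2 t t'

/-- The pair formed by `a` in part `k` and `b` in part `l` is not covered by `S`. -/
def Uncovered (S : Finset (Fin n × Fin n × Fin n)) (k l : Fin 3) (a b : Fin n) : Prop :=
  ∀ t ∈ S, ¬ (coord k t = a ∧ coord l t = b)

lemma uncovered_comm {S : Finset (Fin n × Fin n × Fin n)} {k l : Fin 3} {a b : Fin n} :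
    Uncovered S k l a b ↔ Uncovered S l k b a := by
  simp only [Uncovered, and_comm]

lemma uncovered_insert {S : Finset (Fin n × Fin n × Fin n)} {t : Fin n × Fin n × Fin n}
    {k l : Fin 3} {a b : Fin n} :
    Uncovered (insert t S) k l a b ↔
      ¬ (coord k t = a ∧ coord l t = b) ∧ Uncovered S k l a b := by
  simp [Uncovered]

lemma mem_available_iff {S : Finset (Fin n × Fin n × Fin n)} {t : Fin n × Fin n × Fin n}
    {k l m : Fin 3} (hkl : k ≠ l) (hkm : k ≠ m) (hlm : l ≠ m) :
    t ∈ available S ↔ Uncovered S k l (coord k t) (coord l t) ∧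
      Uncovered S k m (coord k t) (coord m t) ∧ Uncovered S l m (coord l t) (coord m t) := by
  simp only [available, Finset.mem_filter, Finset.mem_univ, true_and, Uncovered,
    shares2_iff hkl hkm hlm, ← forall_and]
  refine forall_congr' fun t' => ?_
  simp only [eq_comm (a := coord _ t')]
  tauto

/-- The vertices of part `l` joined to the vertex `a` of part `k` by a pair not covered by `S`. -/
def neighbors (S : Finset (Fin n × Fin n × Fin n)) (k l : Fin 3) (a : Fin n) : Finset (Fin n) :=
  Finset.univ.filter fun u => Uncovered S k l a u

/-- The vertices of part `m` joined to both `a` in part `k` and `b` in part `l` by pairs not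
covered by `S`. -/
def commonNeighbors (S : Finset (Fin n × Fin n × Fin n)) (k l m : Fin 3) (a b : Fin n) :
    Finset (Fin n) :=
  Finset.univ.filter fun w => Uncovered S k m a w ∧ Uncovered S l m b w

/-- The available triangles whose addition to `S` destroys a common neighbor. -/
def codegreeLoss (k l m : Fin 3) (a b : Fin n) (S : Finset (Fin n × Fin n × Fin n)) :
    Finset (Fin n × Fin n × Fin n) :=
  (available S).filter fun t =>
    (coord k t = a ∨ coord l t = b) ∧ coord m t ∈ commonNeighbors S k l m a b

/-- The available triangles through the vertex `a` of part `k`. -/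
def degreeLoss (k : Fin 3) (a : Fin n) (S : Finset (Fin n × Fin n × Fin n)) :
    Finset (Fin n × Fin n × Fin n) :=
  (available S).filter fun t => coord k t = a

lemma mem_degreeLoss {k : Fin 3} {a : Fin n} {S : Finset (Fin n × Fin n × Fin n)}
    {t : Fin n × Fin n × Fin n} : t ∈ degreeLoss k a S ↔ t ∈ available S ∧ coord k t = a :=
  Finset.mem_filter

lemma card_degreeLoss_le (k : Fin 3) (a : Fin n) (S : Finset (Fin n × Fin n × Fin n)) :
    (degreeLoss k a S).card ≤ 2 * n ^ 2 := by
  have h : degreeLoss k a S ⊆ Finset.univ.filter fun t => coord k t = a :=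
    Finset.filter_subset_filter _ (Finset.subset_univ _)
  have := Finset.card_le_card h
  rw [card_filter_coord_eq] at this
  omega

lemma card_codegreeLoss_le (k l m : Fin 3) (a b : Fin n) (S : Finset (Fin n × Fin n × Fin n)) :
    (codegreeLoss k l m a b S).card ≤ 2 * n ^ 2 := by
  have h : codegreeLoss k l m a b S ⊆ (Finset.univ.filter fun t => coord k t = a) ∪
      Finset.univ.filter fun t => coord l t = b := by
    intro t ht
    simpa using (Finset.mem_filter.1 ht).2.1
  refine (Finset.card_le_card h).trans ((Finset.card_union_le _ _).trans ?_)
  rw [card_filter_coord_eq, card_filter_coord_eq]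
  omega

lemma card_filter_available_edge {S : Finset (Fin n × Fin n × Fin n)} {k l m : Fin 3}
    (hkl : k ≠ l) (hkm : k ≠ m) (hlm : l ≠ m) {a c : Fin n} (hac : Uncovered S k m a c) :
    ((available S).filter fun t => coord k t = a ∧ coord m t = c).card =
      (commonNeighbors S k m l a c).card := by
  refine Finset.card_bij (fun t _ => coord l t) ?_ ?_ ?_
  · intro t ht
    obtain ⟨h1, rfl, rfl⟩ := Finset.mem_filter.1 ht
    rw [mem_available_iff hkl hkm hlm] at h1
    simp [commonNeighbors, h1.1, uncovered_comm.1 h1.2.2]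
  · intro t ht t' ht' heq
    have h1 := (Finset.mem_filter.1 ht).2
    have h2 := (Finset.mem_filter.1 ht').2
    exact coord_ext hkl hkm hlm (h1.1.trans h2.1.symm) heq (h1.2.trans h2.2.symm)
  · intro u hu
    obtain ⟨t, rfl, rfl, rfl⟩ := exists_coord hkl hkm hlm a u c
    simp only [commonNeighbors, Finset.mem_filter, Finset.mem_univ, true_and] at hu
    refine ⟨t, Finset.mem_filter.2 ⟨?_, rfl, rfl⟩, rfl⟩
    rw [mem_available_iff hkl hkm hlm]
    exact ⟨hu.1, hac, uncovered_comm.1 hu.2⟩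

lemma card_filter_available_edges {S : Finset (Fin n × Fin n × Fin n)} {k l m : Fin 3}
    (hkl : k ≠ l) (hkm : k ≠ m) (hlm : l ≠ m) {a : Fin n} {W : Finset (Fin n)}
    (hW : ∀ c ∈ W, Uncovered S k m a c) :
    ((available S).filter fun t => coord k t = a ∧ coord m t ∈ W).card =
      ∑ c ∈ W, (commonNeighbors S k m l a c).card := by
  rw [Finset.card_eq_sum_card_fiberwise (f := coord m) (t := W)
    fun t ht => (Finset.mem_filter.1 ht).2.2]
  refine Finset.sum_congr rfl fun c hc => ?_
  rw [← card_filter_available_edge hkl hkm hlm (hW c hc), Finset.filter_filter]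
  congr 1
  refine Finset.filter_congr fun t _ => ?_
  constructor
  · rintro ⟨⟨h1, -⟩, h2⟩; exact ⟨h1, h2⟩
  · rintro ⟨h1, h2⟩; exact ⟨⟨h1, h2 ▸ hc⟩, h2⟩

lemma card_degreeLoss {k l m : Fin 3} (hkl : k ≠ l) (hkm : k ≠ m) (hlm : l ≠ m) (a : Fin n)
    (S : Finset (Fin n × Fin n × Fin n)) :
    (degreeLoss k a S).card =
      ∑ u ∈ neighbors S k l a, (commonNeighbors S k l m a u).card := by
  rw [← card_filter_available_edges (S := S) (W := neighbors S k l a) hkm hkl hlm.symm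
    fun c hc => (Finset.mem_filter.1 hc).2]
  congr 1
  refine Finset.filter_congr fun t ht => ?_
  rw [mem_available_iff hkl hkm hlm] at ht
  constructor
  · rintro rfl; exact ⟨rfl, by simp [neighbors, ht.1]⟩
  · exact fun h => h.1

lemma card_codegreeLoss_bounds {k l m : Fin 3} (hkl : k ≠ l) (hkm : k ≠ m) (hlm : l ≠ m)
    (a b : Fin n) (S : Finset (Fin n × Fin n × Fin n)) :
    (codegreeLoss k l m a b S).card ≤
        ∑ c ∈ commonNeighbors S k l m a b, (commonNeighbors S k m l a c).card +
        ∑ c ∈ commonNeighbors S k l m a b, (commonNeighbors S l m k b c).card ∧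
      ∑ c ∈ commonNeighbors S k l m a b, (commonNeighbors S k m l a c).card +
        ∑ c ∈ commonNeighbors S k l m a b, (commonNeighbors S l m k b c).card ≤
      (codegreeLoss k l m a b S).card + n := by
  set W := commonNeighbors S k l m a b with hWdef
  have hW : ∀ c ∈ W, Uncovered S k m a c ∧ Uncovered S l m b c := fun c hc =>
    (Finset.mem_filter.1 hc).2
  rw [← card_filter_available_edges hkl hkm hlm fun c hc => (hW c hc).1,
    ← card_filter_available_edges hkl.symm hlm hkm fun c hc => (hW c hc).2]
  set A := (available S).filter fun t => coord k t = a ∧ coord m t ∈ W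
  set B := (available S).filter fun t => coord l t = b ∧ coord m t ∈ W
  have hU : codegreeLoss k l m a b S = A ∪ B := by
    rw [← Finset.filter_or]
    exact Finset.filter_congr fun t _ => by tauto
  have hI : (A ∩ B).card ≤ n := by
    have : (A ∩ B).card ≤ (Finset.univ : Finset (Fin n)).card := by
      refine Finset.card_le_card_of_injOn (coord m) (fun _ _ => Finset.mem_univ _) ?_
      intro t ht t' ht' heq
      simp only [A, B, Finset.coe_inter, Finset.coe_filter, Set.mem_inter_iff,
        Set.mem_ofPred_eq] at ht ht'
      exact coord_ext hkl hkm hlm (ht.1.2.1.trans ht'.1.2.1.symm)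
        (ht.2.2.1.trans ht'.2.2.1.symm) heq
    simpa using this
  have := Finset.card_union_add_card_inter A B
  rw [hU]
  omega

lemma card_commonNeighbors_insert {k l m : Fin 3} {S : Finset (Fin n × Fin n × Fin n)}
    {t : Fin n × Fin n × Fin n} (a b : Fin n)
    (ht : t ∈ available S) :
    ((commonNeighbors (insert t S) k l m a b).card : ℝ) =
      (commonNeighbors S k l m a b).card - if t ∈ codegreeLoss k l m a b S then 1 else 0 := by
  split_ifs with h
  · obtain ⟨-, h1, h2⟩ := Finset.mem_filter.1 h
    have : commonNeighbors (insert t S) k l m a b =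
        (commonNeighbors S k l m a b).erase (coord m t) := by
      ext w
      simp only [commonNeighbors, uncovered_insert, Finset.mem_erase, Finset.mem_filter,
        Finset.mem_univ, true_and]
      tauto
    rw [this, Finset.cast_card_erase_of_mem h2]
  · have : commonNeighbors (insert t S) k l m a b = commonNeighbors S k l m a b := by
      ext w
      have h' : ¬ ((coord k t = a ∨ coord l t = b) ∧
          coord m t ∈ commonNeighbors S k l m a b) := fun h' => h (Finset.mem_filter.2 ⟨ht, h'⟩)
      simp only [commonNeighbors, uncovered_insert, Finset.mem_filter,
        Finset.mem_univ, true_and] at h' ⊢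
      constructor
      · tauto
      · intro hw
        refine ⟨⟨?_, hw.1⟩, ?_, hw.2⟩
        · rintro ⟨h1, rfl⟩; exact h' ⟨Or.inl h1, hw⟩
        · rintro ⟨h1, rfl⟩; exact h' ⟨Or.inr h1, hw⟩
    rw [this, sub_zero]

lemma card_neighbors_insert {k l m : Fin 3} (hkl : k ≠ l) (hkm : k ≠ m) (hlm : l ≠ m)
    {S : Finset (Fin n × Fin n × Fin n)} {t : Fin n × Fin n × Fin n} (a : Fin n)
    (ht : t ∈ available S) :
    ((neighbors (insert t S) k l a).card : ℝ) =
      (neighbors S k l a).card - if t ∈ degreeLoss k a S then 1 else 0 := by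
  split_ifs with h
  · have h1 := (Finset.mem_filter.1 h).2
    have h2 : coord l t ∈ neighbors S k l a := by
      rw [mem_available_iff hkl hkm hlm, h1] at ht
      simpa [neighbors] using ht.1
    have : neighbors (insert t S) k l a = (neighbors S k l a).erase (coord l t) := by
      ext w
      simp only [neighbors, uncovered_insert, Finset.mem_erase, Finset.mem_filter,
        Finset.mem_univ, true_and]
      tauto
    rw [this, Finset.cast_card_erase_of_mem h2]
  · have : neighbors (insert t S) k l a = neighbors S k l a := by
      ext w
      have h' : coord k t ≠ a := fun h' => h (Finset.mem_filter.2 ⟨ht, h'⟩)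
      simp [neighbors, uncovered_insert, h']
    rw [this, sub_zero]

lemma greedySet_succ (σ : Fin (n ^ 3) ≃ (Fin n × Fin n × Fin n)) {i : ℕ} (hi : i < n ^ 3) :
    greedySet n σ (i + 1) = if σ ⟨i, hi⟩ ∈ available (greedySet n σ i)
      then insert (σ ⟨i, hi⟩) (greedySet n σ i) else greedySet n σ i := by
  simp [greedySet, hi, available]

lemma greedySet_subset_succ (σ : Fin (n ^ 3) ≃ (Fin n × Fin n × Fin n)) (i : ℕ) :
    greedySet n σ i ⊆ greedySet n σ (i + 1) := by
  by_cases hi : i < n ^ 3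
  · rw [greedySet_succ σ hi]
    split_ifs
    · exact Finset.subset_insert _ _
    · rfl
  · simp [greedySet, hi]

lemma greedySet_congr {σ σ' : Fin (n ^ 3) ≃ (Fin n × Fin n × Fin n)} {i : ℕ}
    (h : ∀ j : Fin (n ^ 3), (j : ℕ) < i → σ j = σ' j) : greedySet n σ i = greedySet n σ' i := by
  induction i with
  | zero => rfl
  | succ i ih =>
    have hi := ih fun j hj => h j (hj.trans (Nat.lt_succ_self i))
    by_cases hlt : i < n ^ 3
    · rw [greedySet_succ σ hlt, greedySet_succ σ' hlt, hi, h ⟨i, hlt⟩ (Nat.lt_succ_self i)]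
    · simp [greedySet, hlt, hi]

lemma shares2_self (t : Fin n × Fin n × Fin n) : Shares2 t t := Or.inl ⟨rfl, rfl⟩

lemma notMem_available_greedySet (σ : Fin (n ^ 3) ≃ (Fin n × Fin n × Fin n)) {i : ℕ}
    (j : Fin (n ^ 3)) (hj : (j : ℕ) < i) : σ j ∉ available (greedySet n σ i) := by
  have key : ∃ t' ∈ greedySet n σ (j + 1), Shares2 (σ j) t' := by
    rw [greedySet_succ σ j.2]
    split_ifs with h
    · exact ⟨σ j, Finset.mem_insert_self _ _, shares2_self _⟩
    · simpa [available] using h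
  obtain ⟨t', ht', hs⟩ := key
  have hmono : Monotone (greedySet n σ) := monotone_nat_of_le_succ (greedySet_subset_succ σ)
  intro h
  exact (Finset.mem_filter.1 h).2 t' (hmono hj ht') hs

lemma isFreshAdapted_greedySet
    {L : Finset (Fin n × Fin n × Fin n) → Finset (Fin n × Fin n × Fin n)}
    (hL : ∀ S, L S ⊆ available S) :
    IsFreshAdapted fun (σ : Fin (n ^ 3) ≃ (Fin n × Fin n × Fin n)) i => L (greedySet n σ i) where
  adapted σ σ' i h := by rw [greedySet_congr h]
  fresh σ i j hj h := notMem_available_greedySet σ j hj (hL _ h)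

/-- A statistic of the set `S` that starts at `n` and drops by one exactly when a triangle of
`L S` is added is `n` minus the number of hits of `L`. -/
lemma statistic_greedySet_eq
    {L : Finset (Fin n × Fin n × Fin n) → Finset (Fin n × Fin n × Fin n)}
    (hL : ∀ S, L S ⊆ available S) {f : Finset (Fin n × Fin n × Fin n) → ℝ} (h0 : f ∅ = n)
    (hf : ∀ S, ∀ t ∈ available S, f (insert t S) = f S - if t ∈ L S then 1 else 0)
    (σ : Fin (n ^ 3) ≃ (Fin n × Fin n × Fin n)) {i : ℕ} (hi : i ≤ n ^ 3) :
    f (greedySet n σ i) = n - hits (fun σ i => L (greedySet n σ i)) σ i := by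
  induction i with
  | zero => simp [greedySet, hits, h0]
  | succ i ih =>
    have hi' : i < n ^ 3 := hi
    have ih := ih hi'.le
    rw [hits] at ih ⊢
    rw [Finset.sum_range_succ, greedySet_succ σ hi']
    simp only [hi', exists_true_left]
    by_cases h : σ ⟨i, hi'⟩ ∈ available (greedySet n σ i)
    · rw [if_pos h, hf _ _ h, ih]; ring
    · rw [if_neg h, if_neg fun h' => h (hL _ h'), ih]; ring

lemma card_commonNeighbors_greedySet (k l m : Fin 3) (a b : Fin n)
    (σ : Fin (n ^ 3) ≃ (Fin n × Fin n × Fin n)) {i : ℕ} (hi : i ≤ n ^ 3) :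
    ((commonNeighbors (greedySet n σ i) k l m a b).card : ℝ) =
      n - hits (fun σ i => codegreeLoss k l m a b (greedySet n σ i)) σ i :=
  statistic_greedySet_eq (L := codegreeLoss k l m a b)
    (f := fun S => ((commonNeighbors S k l m a b).card : ℝ))
    (fun _ => Finset.filter_subset _ _)
    (by simp [commonNeighbors, Uncovered])
    (fun _ _ => card_commonNeighbors_insert a b) σ hi

lemma card_neighbors_greedySet {k l m : Fin 3} (hkl : k ≠ l) (hkm : k ≠ m) (hlm : l ≠ m)
    (a : Fin n) (σ : Fin (n ^ 3) ≃ (Fin n × Fin n × Fin n)) {i : ℕ} (hi : i ≤ n ^ 3) :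
    ((neighbors (greedySet n σ i) k l a).card : ℝ) =
      n - hits (fun σ i => degreeLoss k a (greedySet n σ i)) σ i :=
  statistic_greedySet_eq (L := degreeLoss k a)
    (f := fun S => ((neighbors S k l a).card : ℝ))
    (fun _ => Finset.filter_subset _ _)
    (by simp [neighbors, Uncovered])
    (fun _ _ => card_neighbors_insert hkl hkm hlm a) σ hi

lemma card_filter_coord_greedySet (k : Fin 3) (a : Fin n)
    (σ : Fin (n ^ 3) ≃ (Fin n × Fin n × Fin n)) {i : ℕ} (hi : i ≤ n ^ 3) :
    (n : ℝ) - ((greedySet n σ i).filter fun t => coord k t = a).card =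
      n - hits (fun σ i => degreeLoss k a (greedySet n σ i)) σ i :=
  statistic_greedySet_eq (L := degreeLoss k a)
    (f := fun S => (n : ℝ) - (S.filter fun t => coord k t = a).card)
    (fun _ => Finset.filter_subset _ _) (by simp)
    (fun S t ht => by
      have hS : t ∉ S := fun h => (Finset.mem_filter.1 ht).2 t h (shares2_self t)
      by_cases h : coord k t = a
      · rw [Finset.filter_insert, if_pos h, Finset.card_insert_of_notMem (by simp [hS]),
          if_pos (mem_degreeLoss.2 ⟨ht, h⟩)]
        push_cast; ring
      · rw [Finset.filter_insert, if_neg h, if_neg fun h' => h (mem_degreeLoss.1 h').2]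
        ring) σ hi

end Greedy

/-! ### Deterministic analysis of the trajectories -/

section Trajectory

/-- Discrete comparison principle: a sequence which is an accumulated drift up to an error `E`
stays close to `z` as long as the drift matches the increments of `z` up to the increments
of `F`. -/
lemma abs_sub_le_of_drift {f c z F : ℕ → ℝ} {E : ℝ} {i : ℕ}
    (hf : |f i - (z 0 - ∑ j ∈ Finset.range i, c j)| ≤ E) (hE : E ≤ F 0)
    (hc : ∀ j < i, |c j + (z (j + 1) - z j)| ≤ F (j + 1) - F j) : |f i - z i| ≤ F i := by
  have h1 : f i - z i = (f i - (z 0 - ∑ j ∈ Finset.range i, c j)) -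
      ∑ j ∈ Finset.range i, (c j + (z (j + 1) - z j)) := by
    rw [Finset.sum_add_distrib, Finset.sum_range_sub]; ring
  have h2 : |∑ j ∈ Finset.range i, (c j + (z (j + 1) - z j))| ≤ F i - F 0 := by
    rw [← Finset.sum_range_sub]
    exact (Finset.abs_sum_le_sum_abs _ _).trans
      (Finset.sum_le_sum fun j hj => hc j (Finset.mem_range.1 hj))
  rw [h1]
  have := abs_sub (f i - (z 0 - ∑ j ∈ Finset.range i, c j))
    (∑ j ∈ Finset.range i, (c j + (z (j + 1) - z j)))
  linarith

/-- The squared inverse density of uncovered pairs after `j` steps. -/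
def timeScale (n : ℝ) (j : ℕ) : ℝ := 1 + 2 * (j : ℝ) / n ^ 2

lemma one_le_timeScale (n : ℝ) (j : ℕ) : 1 ≤ timeScale n j := by
  unfold timeScale; linarith [show 0 ≤ 2 * (j : ℝ) / n ^ 2 by positivity]

lemma timeScale_succ (n : ℝ) (j : ℕ) : timeScale n (j + 1) = timeScale n j + 2 / n ^ 2 := by
  unfold timeScale; push_cast; ring

lemma timeScale_le {r : ℝ} (hr : 1 ≤ r) {j : ℕ} (hj : (j : ℝ) ≤ r ^ 65) :
    timeScale (r ^ 32) j ≤ 3 * r := by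
  unfold timeScale
  have : 2 * (j : ℝ) / (r ^ 32) ^ 2 ≤ 2 * r := by
    rw [div_le_iff₀ (by positivity)]; nlinarith
  linarith

lemma inv_sub_bounds {r j : ℝ} (hr : 2 ≤ r) (hj0 : 0 ≤ j) (hj : j ≤ r ^ 65) :
    0 ≤ 1 / ((r ^ 32) ^ 3 - j) ∧ 1 / ((r ^ 32) ^ 3 - j) ≤ 7 / 6 / (r ^ 32) ^ 3 ∧
      0 ≤ 1 / ((r ^ 32) ^ 3 - j) - 1 / (r ^ 32) ^ 3 ∧
      1 / ((r ^ 32) ^ 3 - j) - 1 / (r ^ 32) ^ 3 ≤ 7 / 6 * r ^ 65 / (r ^ 32) ^ 6 := by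
  set A : ℝ := (r ^ 32) ^ 3 with hA
  have hA0 : 0 < A := by positivity
  have h31 : (7 : ℝ) ≤ r ^ 31 :=
    calc (7 : ℝ) ≤ 2 ^ 31 := by norm_num
      _ ≤ r ^ 31 := by gcongr
  have hjA : 7 * j ≤ A := by
    have : r ^ 31 * r ^ 65 = A := by rw [hA]; ring
    nlinarith [show (0 : ℝ) ≤ r ^ 65 by positivity]
  have hpos : 0 < A - j := by linarith
  have hw : 1 / (A - j) ≤ 7 / 6 / A := by
    rw [div_le_div_iff₀ hpos hA0]; linarith
  have hdiff : 1 / (A - j) - 1 / A = j * (1 / (A - j)) / A := by field_simp; ring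
  refine ⟨by positivity, hw, ?_, ?_⟩
  · rw [hdiff]; positivity
  · rw [hdiff]
    calc j * (1 / (A - j)) / A ≤ r ^ 65 * (7 / 6 / A) / A := by gcongr
      _ = 7 / 6 * r ^ 65 / (r ^ 32) ^ 6 := by rw [hA]; field_simp

lemma codegree_step {r κ : ℝ} (hr : 2 ≤ r) {j : ℕ} (hj : (j : ℝ) ≤ r ^ 65)
    (hκ : |κ - 2 * (r ^ 32 / timeScale (r ^ 32) j) ^ 2| ≤
      6 * (r ^ 32 / timeScale (r ^ 32) j) * (r ^ 24 * timeScale (r ^ 32) j ^ 4) + r ^ 32) :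
    |κ / ((r ^ 32) ^ 3 - j) +
        (r ^ 32 / timeScale (r ^ 32) (j + 1) - r ^ 32 / timeScale (r ^ 32) j)| ≤
      r ^ 24 * timeScale (r ^ 32) (j + 1) ^ 4 - r ^ 24 * timeScale (r ^ 32) j ^ 4 := by
  obtain ⟨hw0, hw1, hw2, hw3⟩ := inv_sub_bounds hr (Nat.cast_nonneg j) hj
  have hx := one_le_timeScale (r ^ 32) j
  rw [timeScale_succ]
  set x := timeScale (r ^ 32) j
  set n : ℝ := r ^ 32 with hn
  set w : ℝ := 1 / (n ^ 3 - j)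
  have hn1 : 1 ≤ n := one_le_pow₀ (by linarith)
  have hn0 : 0 < n := by linarith
  have hx0 : 0 < x := by linarith
  have hx1 : 0 < x + 2 / n ^ 2 := by positivity
  have hsplit : κ / (n ^ 3 - j) + (n / (x + 2 / n ^ 2) - n / x) =
      (κ - 2 * (n / x) ^ 2) * w + 2 * (n / x) ^ 2 * (w - 1 / n ^ 3) +
        4 / (n ^ 3 * x ^ 2 * (x + 2 / n ^ 2)) := by
    have : κ / (n ^ 3 - j) = κ * w := by rw [mul_one_div]
    rw [this]
    have h3 : n / (x + 2 / n ^ 2) - n / x = - 2 * (n / x) ^ 2 * (1 / n ^ 3) +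
        4 / (n ^ 3 * x ^ 2 * (x + 2 / n ^ 2)) := by
      field_simp; ring
    rw [h3]; ring
  have hT1 : |(κ - 2 * (n / x) ^ 2) * w| ≤ (7 * r ^ 24 * x ^ 3 + 7 / 6) / n ^ 2 := by
    rw [abs_mul, abs_of_nonneg hw0]
    calc |κ - 2 * (n / x) ^ 2| * w
        ≤ (6 * (n / x) * (r ^ 24 * x ^ 4) + n) * (7 / 6 / n ^ 3) := by gcongr
      _ = _ := by field_simp
  have hyn : n / x ≤ n := div_le_self hn0.le hx
  have hT2 : |2 * (n / x) ^ 2 * (w - 1 / n ^ 3)| ≤ (7 / 3 * r) / n ^ 2 := by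
    rw [abs_of_nonneg (by positivity)]
    calc 2 * (n / x) ^ 2 * (w - 1 / n ^ 3) ≤ 2 * n ^ 2 * (7 / 6 * r ^ 65 / n ^ 6) := by gcongr
      _ = _ := by rw [hn]; field_simp; norm_num
  have hT3 : |4 / (n ^ 3 * x ^ 2 * (x + 2 / n ^ 2))| ≤ 4 / n ^ 2 := by
    rw [abs_of_nonneg (by positivity)]
    refine div_le_div_of_nonneg_left (by norm_num) (by positivity) ?_
    have h1 : 1 ≤ x + 2 / n ^ 2 := by linarith [show 0 ≤ 2 / n ^ 2 by positivity]
    have h2 : 1 ≤ x ^ 2 := one_le_pow₀ hx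
    calc n ^ 2 = n ^ 2 * 1 * 1 := by ring
      _ ≤ n ^ 3 * x ^ 2 * (x + 2 / n ^ 2) := by
        have h3 : n ^ 2 ≤ n ^ 3 := pow_le_pow_right₀ hn1 (by norm_num)
        gcongr
  have hR : 8 * r ^ 24 * x ^ 3 / n ^ 2 ≤
      r ^ 24 * (x + 2 / n ^ 2) ^ 4 - r ^ 24 * x ^ 4 := by
    have h0 : 0 ≤ 2 / n ^ 2 := by positivity
    have : r ^ 24 * (x + 2 / n ^ 2) ^ 4 - r ^ 24 * x ^ 4 = 8 * r ^ 24 * x ^ 3 / n ^ 2 +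
        r ^ 24 * (6 * x ^ 2 * (2 / n ^ 2) ^ 2 + 4 * x * (2 / n ^ 2) ^ 3 + (2 / n ^ 2) ^ 4) := by
      ring
    rw [this]
    exact le_add_of_nonneg_right (by positivity)
  have hsmall : 7 / 6 + 7 / 3 * r + 4 ≤ r ^ 24 * x ^ 3 := by
    have h1 : 1 ≤ x ^ 3 := one_le_pow₀ hx
    have h2 : (2 : ℝ) ^ 23 ≤ r ^ 23 := by gcongr
    have h3 : r ^ 24 = r ^ 23 * r := by ring
    have h4 : r ^ 24 * 1 ≤ r ^ 24 * x ^ 3 := by gcongr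
    nlinarith
  rw [hsplit]
  calc _ ≤ (7 * r ^ 24 * x ^ 3 + 7 / 6) / n ^ 2 + (7 / 3 * r) / n ^ 2 + 4 / n ^ 2 :=
        (abs_add_three _ _ _).trans (by gcongr)
    _ = (7 * r ^ 24 * x ^ 3 + (7 / 6 + 7 / 3 * r + 4)) / n ^ 2 := by ring
    _ ≤ (7 * r ^ 24 * x ^ 3 + r ^ 24 * x ^ 3) / n ^ 2 := by gcongr
    _ = 8 * r ^ 24 * x ^ 3 / n ^ 2 := by ring
    _ ≤ _ := hR

lemma codegree_error_le {r : ℝ} (hr : 243 ≤ r) {j : ℕ} (hj : (j : ℝ) ≤ r ^ 65) :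
    r ^ 24 * timeScale (r ^ 32) j ^ 4 ≤ r ^ 32 / timeScale (r ^ 32) j := by
  have hx := one_le_timeScale (r ^ 32) j
  have hx3 := timeScale_le (by linarith : 1 ≤ r) hj
  rw [le_div_iff₀ (by linarith)]
  calc r ^ 24 * timeScale (r ^ 32) j ^ 4 * timeScale (r ^ 32) j
      = r ^ 24 * timeScale (r ^ 32) j ^ 5 := by ring
    _ ≤ r ^ 24 * (3 * r) ^ 5 := by gcongr
    _ = r ^ 29 * 243 := by ring
    _ ≤ r ^ 29 * r ^ 3 := by gcongr; exact hr.trans (le_self_pow₀ (by linarith) (by norm_num))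
    _ = r ^ 32 := by ring

lemma codegree_trajectory {ι : Type*} {r : ℝ} (hr : 243 ≤ r) {M : ℕ} (hM : (M : ℝ) ≤ r ^ 65)
    {Y κ : ι → ℕ → ℝ}
    (hY : ∀ p, ∀ i ≤ M, |Y p i - (r ^ 32 -
      ∑ j ∈ Finset.range i, κ p j / ((r ^ 32) ^ 3 - j))| ≤ r ^ 24)
    (hκ : ∀ j ≤ M, ∀ F, F ≤ r ^ 32 / timeScale (r ^ 32) j →
      (∀ p, |Y p j - r ^ 32 / timeScale (r ^ 32) j| ≤ F) →
      ∀ p, |κ p j - 2 * (r ^ 32 / timeScale (r ^ 32) j) ^ 2| ≤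
        6 * (r ^ 32 / timeScale (r ^ 32) j) * F + r ^ 32)
    {i : ℕ} (hi : i ≤ M) (p : ι) :
    |Y p i - r ^ 32 / timeScale (r ^ 32) i| ≤ r ^ 24 * timeScale (r ^ 32) i ^ 4 := by
  induction i using Nat.strong_induction_on generalizing p with
  | _ i ih =>
    refine abs_sub_le_of_drift (f := Y p) (c := fun j => κ p j / ((r ^ 32) ^ 3 - j))
      (z := fun i => r ^ 32 / timeScale (r ^ 32) i)
      (F := fun i => r ^ 24 * timeScale (r ^ 32) i ^ 4) (E := r ^ 24) ?_ ?_ ?_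
    · simpa [timeScale] using hY p i hi
    · simp [timeScale]
    · intro j hj
      have hjM : j ≤ M := hj.le.trans hi
      have hj65 : (j : ℝ) ≤ r ^ 65 := le_trans (by exact_mod_cast hjM) hM
      exact codegree_step (by linarith) hj65
        (hκ j hjM _ (codegree_error_le hr hj65) (fun p => ih j hj hjM p) p)

lemma sqrt_increment {n x : ℝ} (hn : 1 ≤ n) (hx : 1 ≤ x) :
    |n / √x * (n / x) / n ^ 3 + (n / √(x + 2 / n ^ 2) - n / √x)| ≤ 8 / n ^ 2 := by
  have hn0 : 0 < n := by linarith
  have hh : 0 ≤ 2 / n ^ 2 := by positivity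
  set a := √x with ha
  set b := √(x + 2 / n ^ 2) with hb
  have haa : a ^ 2 = x := Real.sq_sqrt (by linarith)
  have hbb : b ^ 2 = x + 2 / n ^ 2 := Real.sq_sqrt (by linarith)
  have ha1 : 1 ≤ a := Real.one_le_sqrt.2 hx
  have hab : a ≤ b := Real.sqrt_le_sqrt (by linarith)
  have hd : (b - a) * (b + a) = 2 / n ^ 2 := by linear_combination hbb - haa
  have hd0 : 0 ≤ b - a := by linarith
  have hb1 : 1 ≤ b := ha1.trans hab
  have hd1 : b - a ≤ 2 / n ^ 2 := by rw [← hd]; nlinarith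
  have ha0 : 0 < a := by linarith
  have hb0 : 0 < b := by linarith
  have key : n / a * (n / x) / n ^ 3 + (n / b - n / a) =
      n * (b - a) ^ 2 * (b + 2 * a) / (2 * a ^ 3 * b) := by
    rw [← haa]
    have : n / a * (n / a ^ 2) / n ^ 3 = n * ((b - a) * (b + a)) / (2 * a ^ 3) := by
      rw [hd]; field_simp
    rw [this]; field_simp; ring
  rw [key, abs_of_nonneg (by positivity)]
  have h1 : (b + 2 * a) / (2 * a ^ 3 * b) ≤ 2 := by
    rw [div_le_iff₀ (by positivity)]
    have : 1 * b ≤ a ^ 3 * b := by gcongr; exact one_le_pow₀ ha1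
    nlinarith
  calc n * (b - a) ^ 2 * (b + 2 * a) / (2 * a ^ 3 * b)
      = n * (b - a) ^ 2 * ((b + 2 * a) / (2 * a ^ 3 * b)) := by ring
    _ ≤ n * (2 / n ^ 2) ^ 2 * 2 := by gcongr
    _ = 8 / n ^ 3 := by field_simp; norm_num
    _ ≤ 8 / n ^ 2 := by gcongr; norm_num

lemma degree_step {r κ D : ℝ} (hr : 2 ≤ r) {j : ℕ} (hj : (j : ℝ) ≤ r ^ 65)
    (hD0 : |D| ≤ r ^ 32)
    (hκ : |κ - D * (r ^ 32 / timeScale (r ^ 32) j)| ≤ |D| * (81 * r ^ 28))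
    (hD : |D - r ^ 32 / √(timeScale (r ^ 32) j)| ≤ 82 * r ^ 28 * timeScale (r ^ 32) j ^ 2) :
    |κ / ((r ^ 32) ^ 3 - j) +
        (r ^ 32 / √(timeScale (r ^ 32) (j + 1)) - r ^ 32 / √(timeScale (r ^ 32) j))| ≤
      82 * r ^ 28 * timeScale (r ^ 32) (j + 1) ^ 2 - 82 * r ^ 28 * timeScale (r ^ 32) j ^ 2 := by
  obtain ⟨hw0, hw1, hw2, hw3⟩ := inv_sub_bounds hr (Nat.cast_nonneg j) hj
  have hx := one_le_timeScale (r ^ 32) j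
  rw [timeScale_succ]
  set x := timeScale (r ^ 32) j
  set n : ℝ := r ^ 32 with hn
  set w : ℝ := 1 / (n ^ 3 - j)
  have hn1 : 1 ≤ n := one_le_pow₀ (by linarith)
  have hn0 : 0 < n := by linarith
  have hx0 : 0 < x := by linarith
  have hsplit : κ / (n ^ 3 - j) + (n / √(x + 2 / n ^ 2) - n / √x) =
      ((κ - D * (n / x)) + (D - n / √x) * (n / x)) * w + n / √x * (n / x) * (w - 1 / n ^ 3) +
        (n / √x * (n / x) / n ^ 3 + (n / √(x + 2 / n ^ 2) - n / √x)) := by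
    have : κ / (n ^ 3 - j) = κ * w := by rw [mul_one_div]
    rw [this]; ring
  have hT1 : |((κ - D * (n / x)) + (D - n / √x) * (n / x)) * w| ≤
      (7 / 6 * 81 * r ^ 28 + 7 / 6 * 82 * r ^ 28 * x) / n ^ 2 := by
    rw [abs_mul, abs_of_nonneg hw0]
    calc |(κ - D * (n / x)) + (D - n / √x) * (n / x)| * w
        ≤ (n * (81 * r ^ 28) + 82 * r ^ 28 * x ^ 2 * (n / x)) * (7 / 6 / n ^ 3) := by
          gcongr
          refine (abs_add_le _ _).trans ?_
          rw [abs_mul, abs_of_nonneg (by positivity : 0 ≤ n / x)]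
          have h1 : |κ - D * (n / x)| ≤ n * (81 * r ^ 28) := hκ.trans (by gcongr)
          gcongr
      _ = _ := by field_simp
  have hyn : n / x ≤ n := div_le_self hn0.le hx
  have hdn : n / √x ≤ n := div_le_self hn0.le (Real.one_le_sqrt.2 hx)
  have hT2 : |n / √x * (n / x) * (w - 1 / n ^ 3)| ≤ (7 / 6 * r) / n ^ 2 := by
    rw [abs_of_nonneg (by positivity)]
    calc n / √x * (n / x) * (w - 1 / n ^ 3) ≤ n * n * (7 / 6 * r ^ 65 / n ^ 6) := by gcongr
      _ = _ := by rw [hn]; field_simp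
  have hT3 := sqrt_increment hn1 hx
  have hR : 4 * (82 * r ^ 28) * x / n ^ 2 ≤
      82 * r ^ 28 * (x + 2 / n ^ 2) ^ 2 - 82 * r ^ 28 * x ^ 2 := by
    have : 82 * r ^ 28 * (x + 2 / n ^ 2) ^ 2 - 82 * r ^ 28 * x ^ 2 =
        4 * (82 * r ^ 28) * x / n ^ 2 + 82 * r ^ 28 * (2 / n ^ 2) ^ 2 := by ring
    rw [this]
    exact le_add_of_nonneg_right (by positivity)
  have hsmall : 7 / 6 * 81 * r ^ 28 + 7 / 6 * 82 * r ^ 28 * x + 7 / 6 * r + 8 ≤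
      4 * (82 * r ^ 28) * x := by
    have h2 : (2 : ℝ) ^ 27 ≤ r ^ 27 := by gcongr
    have h3 : r ^ 28 = r ^ 27 * r := by ring
    have h4 : r ^ 28 * 1 ≤ r ^ 28 * x := by gcongr
    nlinarith
  rw [hsplit]
  calc _ ≤ (7 / 6 * 81 * r ^ 28 + 7 / 6 * 82 * r ^ 28 * x) / n ^ 2 + (7 / 6 * r) / n ^ 2 +
        8 / n ^ 2 := (abs_add_three _ _ _).trans (by gcongr)
    _ = (7 / 6 * 81 * r ^ 28 + 7 / 6 * 82 * r ^ 28 * x + 7 / 6 * r + 8) / n ^ 2 := by ring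
    _ ≤ (4 * (82 * r ^ 28) * x) / n ^ 2 := by gcongr
    _ ≤ _ := hR

lemma degree_trajectory {r : ℝ} (hr : 2 ≤ r) {M : ℕ} (hM : (M : ℝ) ≤ r ^ 65) {D κ : ℕ → ℝ}
    (hD : ∀ i ≤ M, |D i - (r ^ 32 - ∑ j ∈ Finset.range i, κ j / ((r ^ 32) ^ 3 - j))| ≤ r ^ 24)
    (hD0 : ∀ i ≤ M, |D i| ≤ r ^ 32)
    (hκ : ∀ j ≤ M, |κ j - D j * (r ^ 32 / timeScale (r ^ 32) j)| ≤ |D j| * (81 * r ^ 28))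
    {i : ℕ} (hi : i ≤ M) :
    |D i - r ^ 32 / √(timeScale (r ^ 32) i)| ≤ 82 * r ^ 28 * timeScale (r ^ 32) i ^ 2 := by
  induction i using Nat.strong_induction_on with
  | _ i ih =>
    refine abs_sub_le_of_drift (f := D) (c := fun j => κ j / ((r ^ 32) ^ 3 - j))
      (z := fun i => r ^ 32 / √(timeScale (r ^ 32) i))
      (F := fun i => 82 * r ^ 28 * timeScale (r ^ 32) i ^ 2) (E := r ^ 24) ?_ ?_ ?_
    · simpa [timeScale] using hD i hi
    · have : r ^ 24 ≤ r ^ 28 := pow_le_pow_right₀ (by linarith) (by norm_num)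
      simp only [timeScale, Nat.cast_zero, mul_zero, zero_div, add_zero, one_pow, mul_one]
      nlinarith [show 0 ≤ r ^ 24 by positivity]
    · intro j hj
      have hjM : j ≤ M := hj.le.trans hi
      have hj65 : (j : ℝ) ≤ r ^ 65 := le_trans (by exact_mod_cast hjM) hM
      exact degree_step hr hj65 (hD0 j hjM) (hκ j hjM) (ih j hj hjM)

lemma degree_error_le {r η : ℝ} (hr : 1 ≤ r) (hη : 2214 ≤ η * r) {j : ℕ}
    (hj : (j : ℝ) ≤ r ^ 65) :
    82 * r ^ 28 * timeScale (r ^ 32) j ^ 2 ≤ η * (r ^ 32 / √(timeScale (r ^ 32) j)) := by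
  have hx := one_le_timeScale (r ^ 32) j
  have hx3 := timeScale_le hr hj
  have hs1 : 1 ≤ √(timeScale (r ^ 32) j) := Real.one_le_sqrt.2 hx
  have hs : √(timeScale (r ^ 32) j) ≤ 3 * r := by
    refine (Real.sqrt_le_left (by linarith)).2 ?_
    nlinarith
  rw [mul_div_assoc', le_div_iff₀ (by linarith)]
  calc 82 * r ^ 28 * timeScale (r ^ 32) j ^ 2 * √(timeScale (r ^ 32) j)
      ≤ 82 * r ^ 28 * (3 * r) ^ 2 * (3 * r) := by gcongr
    _ = 2214 * r ^ 31 := by ring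
    _ ≤ η * r * r ^ 31 := by gcongr
    _ = η * r ^ 32 := by ring

end Trajectory

/-! ### Assembling the proof -/

section Main

variable {n : ℕ}

/-- The index type of the tracked statistics: codegrees of pairs, and degrees of vertices. -/
abbrev StatIndex (n : ℕ) : Type :=
  (Fin 3 × Fin 3 × Fin 3 × Fin n × Fin n) ⊕ (Fin 3 × Fin n)

/-- The triangles whose addition decreases the given statistic. -/
def statLoss (S : Finset (Fin n × Fin n × Fin n)) :
    StatIndex n → Finset (Fin n × Fin n × Fin n)
  | Sum.inl (k, l, m, a, b) => codegreeLoss k l m a b S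
  | Sum.inr (k, a) => degreeLoss k a S

lemma statLoss_subset (p : StatIndex n) (S : Finset (Fin n × Fin n × Fin n)) :
    statLoss S p ⊆ available S := by
  rcases p with ⟨k, l, m, a, b⟩ | ⟨k, a⟩ <;> exact Finset.filter_subset _ _

lemma card_statLoss_le (p : StatIndex n) (S : Finset (Fin n × Fin n × Fin n)) :
    (statLoss S p).card ≤ 2 * n ^ 2 := by
  rcases p with ⟨k, l, m, a, b⟩ | ⟨k, a⟩
  · exact card_codegreeLoss_le k l m a b S
  · exact card_degreeLoss_le k a S

/-- The deviation of the given statistic from its compensated value. -/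
def statDeviation (σ : Fin (n ^ 3) ≃ (Fin n × Fin n × Fin n)) (p : StatIndex n) (i : ℕ) : ℝ :=
  |hits (fun σ i => statLoss (greedySet n σ i) p) σ i -
    compensator (fun σ i => statLoss (greedySet n σ i) p) σ i|

lemma abs_card_codegreeLoss_sub_le {k l m : Fin 3} (hkl : k ≠ l) (hkm : k ≠ m) (hlm : l ≠ m)
    (a b : Fin n) {S : Finset (Fin n × Fin n × Fin n)} {y F : ℝ} (hF : F ≤ y)
    (hab : |((commonNeighbors S k l m a b).card : ℝ) - y| ≤ F)
    (ha : ∀ c, |((commonNeighbors S k m l a c).card : ℝ) - y| ≤ F)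
    (hb : ∀ c, |((commonNeighbors S l m k b c).card : ℝ) - y| ≤ F) :
    |((codegreeLoss k l m a b S).card : ℝ) - 2 * y ^ 2| ≤ 6 * y * F + n := by
  obtain ⟨h1, h2⟩ := card_codegreeLoss_bounds hkl hkm hlm a b S
  have hF0 : 0 ≤ F := (abs_nonneg _).trans hab
  have hsum : ∀ g : Fin n → ℝ, (∀ c, |g c - y| ≤ F) →
      |∑ c ∈ commonNeighbors S k l m a b, g c - y ^ 2| ≤ 3 * y * F := by
    intro g hg
    set W := commonNeighbors S k l m a b
    have hW : |∑ c ∈ W, g c - W.card * y| ≤ W.card * F := by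
      rw [← nsmul_eq_mul, ← Finset.sum_const, ← Finset.sum_sub_distrib, ← nsmul_eq_mul]
      exact (Finset.abs_sum_le_sum_abs _ _).trans
        (Finset.sum_le_card_nsmul _ _ _ fun c _ => hg c)
    have hW' : (W.card : ℝ) ≤ 2 * y := by linarith [(abs_le.1 hab).2]
    have hWy : |(W.card : ℝ) * y - y ^ 2| ≤ F * y := by
      rw [sq, ← sub_mul, abs_mul, abs_of_nonneg (hF0.trans hF)]
      exact mul_le_mul_of_nonneg_right hab (hF0.trans hF)
    have h3 := abs_sub_le (∑ c ∈ W, g c) (W.card * y) (y ^ 2)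
    nlinarith [mul_le_mul_of_nonneg_right hW' hF0]
  have hsa := abs_le.1 (hsum _ ha)
  have hsb := abs_le.1 (hsum _ hb)
  have h1' : ((codegreeLoss k l m a b S).card : ℝ) ≤
      ∑ c ∈ commonNeighbors S k l m a b, ((commonNeighbors S k m l a c).card : ℝ) +
        ∑ c ∈ commonNeighbors S k l m a b, ((commonNeighbors S l m k b c).card : ℝ) := by
    exact_mod_cast h1
  have h2' : ∑ c ∈ commonNeighbors S k l m a b, ((commonNeighbors S k m l a c).card : ℝ) +
        ∑ c ∈ commonNeighbors S k l m a b, ((commonNeighbors S l m k b c).card : ℝ) ≤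
      ((codegreeLoss k l m a b S).card : ℝ) + n := by
    exact_mod_cast h2
  rw [abs_le]
  constructor <;> linarith [hsa.1, hsa.2, hsb.1, hsb.2, (Nat.cast_nonneg n : (0 : ℝ) ≤ n)]

lemma abs_card_degreeLoss_sub_le {k l m : Fin 3} (hkl : k ≠ l) (hkm : k ≠ m) (hlm : l ≠ m)
    (a : Fin n) {S : Finset (Fin n × Fin n × Fin n)} {y F : ℝ}
    (ha : ∀ u, |((commonNeighbors S k l m a u).card : ℝ) - y| ≤ F) :
    |((degreeLoss k a S).card : ℝ) - (neighbors S k l a).card * y| ≤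
      (neighbors S k l a).card * F := by
  rw [card_degreeLoss hkl hkm hlm, Nat.cast_sum, ← nsmul_eq_mul, ← Finset.sum_const,
    ← Finset.sum_sub_distrib, ← nsmul_eq_mul]
  exact (Finset.abs_sum_le_sum_abs _ _).trans
    (Finset.sum_le_card_nsmul _ _ _ fun u _ => ha u)

lemma cube_cast {r : ℝ} (hn : (n : ℝ) = r ^ 32) : ((n ^ 3 : ℕ) : ℝ) = (r ^ 32) ^ 3 := by
  rw [Nat.cast_pow, hn]

lemma le_cube_of_le {r : ℝ} (hr : 1 ≤ r) (hn : (n : ℝ) = r ^ 32) {M : ℕ}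
    (hM : (M : ℝ) ≤ r ^ 65) : M ≤ n ^ 3 := by
  have : (M : ℝ) ≤ ((n ^ 3 : ℕ) : ℝ) := by
    rw [cube_cast hn, ← pow_mul]
    exact hM.trans (pow_le_pow_right₀ hr (by norm_num))
  exact_mod_cast this

lemma codegree_concentration {r : ℝ} (hr : 243 ≤ r) (hn : (n : ℝ) = r ^ 32) {M : ℕ}
    (hM : (M : ℝ) ≤ r ^ 65) {σ : Fin (n ^ 3) ≃ (Fin n × Fin n × Fin n)}
    (hσ : ∀ p, ∀ i ≤ M, statDeviation σ p i ≤ r ^ 24) {k l m : Fin 3} (hkl : k ≠ l)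
    (hkm : k ≠ m) (hlm : l ≠ m) (a b : Fin n) {i : ℕ} (hi : i ≤ M) :
    |((commonNeighbors (greedySet n σ i) k l m a b).card : ℝ) - r ^ 32 / timeScale (r ^ 32) i| ≤
      r ^ 24 * timeScale (r ^ 32) i ^ 4 := by
  let ι := {q : Fin 3 × Fin 3 × Fin 3 // q.1 ≠ q.2.1 ∧ q.1 ≠ q.2.2 ∧ q.2.1 ≠ q.2.2} × Fin n × Fin n
  refine codegree_trajectory (ι := ι) hr hM
    (Y := fun p i => ((commonNeighbors (greedySet n σ i) p.1.1.1 p.1.1.2.1 p.1.1.2.2 p.2.1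
      p.2.2).card : ℝ))
    (κ := fun p i => ((codegreeLoss p.1.1.1 p.1.1.2.1 p.1.1.2.2 p.2.1 p.2.2
      (greedySet n σ i)).card : ℝ)) ?_ ?_ hi (⟨(k, l, m), hkl, hkm, hlm⟩, a, b)
  · rintro ⟨⟨⟨k, l, m⟩, hkl, hkm, hlm⟩, a, b⟩ i hi
    have h := hσ (Sum.inl (k, l, m, a, b)) i hi
    simp only [statDeviation, statLoss, compensator, cube_cast hn] at h
    dsimp only
    rw [card_commonNeighbors_greedySet k l m a b σ
      (hi.trans (le_cube_of_le (by linarith) hn hM)), hn, abs_sub_comm]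
    convert h using 2
    ring
  · rintro j - F hF hY ⟨⟨⟨k, l, m⟩, hkl, hkm, hlm⟩, a, b⟩
    have := abs_card_codegreeLoss_sub_le hkl hkm hlm a b hF
      (hY (⟨(k, l, m), hkl, hkm, hlm⟩, a, b))
      (fun c => hY (⟨(k, m, l), hkm, hkl, hlm.symm⟩, a, c))
      (fun c => hY (⟨(l, m, k), hlm, hkl.symm, hkm.symm⟩, b, c))
    rwa [hn] at this

lemma degree_concentration {r η : ℝ} (hr : 243 ≤ r) (hη : 2214 ≤ η * r) (hn : (n : ℝ) = r ^ 32)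
    {M : ℕ} (hM : (M : ℝ) ≤ r ^ 65) {σ : Fin (n ^ 3) ≃ (Fin n × Fin n × Fin n)}
    (hσ : ∀ p, ∀ i ≤ M, statDeviation σ p i ≤ r ^ 24) (k : Fin 3) (a : Fin n) {i : ℕ}
    (hi : i ≤ M) :
    |(n : ℝ) - (((greedySet n σ i).filter fun t => coord k t = a).card : ℝ) -
        n / √(timeScale n i)| ≤ η * (n / √(timeScale n i)) := by
  obtain ⟨l, m, hkl, hkm, hlm⟩ : ∃ l m : Fin 3, k ≠ l ∧ k ≠ m ∧ l ≠ m := by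
    fin_cases k
    · exact ⟨1, 2, by simp⟩
    · exact ⟨0, 2, by simp⟩
    · exact ⟨0, 1, by simp⟩
  have hr1 : 1 ≤ r := by linarith
  have hcube : ∀ i ≤ M, i ≤ n ^ 3 := fun i hi => hi.trans (le_cube_of_le hr1 hn hM)
  rw [card_filter_coord_greedySet k a σ (hcube i hi),
    ← card_neighbors_greedySet hkl hkm hlm a σ (hcube i hi), hn]
  refine (degree_trajectory (by linarith) hM
    (D := fun i => ((neighbors (greedySet n σ i) k l a).card : ℝ))
    (κ := fun i => ((degreeLoss k a (greedySet n σ i)).card : ℝ)) ?_ ?_ ?_ hi).trans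
    (degree_error_le hr1 hη (le_trans (by exact_mod_cast hi) hM))
  · intro i hi
    have h := hσ (Sum.inr (k, a)) i hi
    simp only [statDeviation, statLoss, compensator, cube_cast hn] at h
    rw [card_neighbors_greedySet hkl hkm hlm a σ (hcube i hi), hn, abs_sub_comm]
    convert h using 2
    ring
  · intro i _
    rw [Nat.abs_cast, ← hn]
    exact_mod_cast (Finset.card_le_univ _).trans_eq (Fintype.card_fin n)
  · intro j hj
    rw [Nat.abs_cast]
    refine abs_card_degreeLoss_sub_le hkl hkm hlm a fun u => ?_
    have hj65 : (j : ℝ) ≤ r ^ 65 := le_trans (by exact_mod_cast hj) hM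
    have h3 := timeScale_le hr1 hj65
    have h1 := one_le_timeScale (r ^ 32) j
    refine (codegree_concentration hr hn hM hσ hkl hkm hlm a u hj).trans ?_
    calc r ^ 24 * timeScale (r ^ 32) j ^ 4 ≤ r ^ 24 * (3 * r) ^ 4 := by gcongr
      _ = 81 * r ^ 28 := by ring

lemma card_statDeviation_le {r : ℝ} (hr : 2 ≤ r) (hn : (n : ℝ) = r ^ 32) (p : StatIndex n) {i : ℕ}
    (hi : (i : ℝ) ≤ r ^ 65) :
    ((Finset.univ.filter fun σ : Fin (n ^ 3) ≃ (Fin n × Fin n × Fin n) =>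
        r ^ 24 < statDeviation σ p i).card : ℝ) ≤
      Fintype.card (Fin (n ^ 3) ≃ (Fin n × Fin n × Fin n)) * (2 * Real.exp (1 - r ^ 4)) := by
  have hr0 : 0 < r := by linarith
  refine (card_hits_deviation_le (isFreshAdapted_greedySet (L := fun S => statLoss S p)
    (statLoss_subset p)) (s := (r ^ 20)⁻¹) (p := 4 / r ^ 32) (by positivity)
    (inv_le_one_of_one_le₀ (one_le_pow₀ (by linarith)))
    (le_cube_of_le (by linarith) hn hi) ?_).trans ?_
  · intro σ j hj
    have hj65 : (j : ℝ) ≤ r ^ 65 := le_trans (by exact_mod_cast hj.le) hi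
    obtain ⟨h0, h1, -, -⟩ := inv_sub_bounds hr (Nat.cast_nonneg j) hj65
    have hcard : ((statLoss (greedySet n σ j) p).card : ℝ) ≤ 2 * (r ^ 32) ^ 2 := by
      rw [← hn]; exact_mod_cast card_statLoss_le p (greedySet n σ j)
    rw [cube_cast hn, div_eq_mul_one_div]
    calc ((statLoss (greedySet n σ j) p).card : ℝ) * (1 / ((r ^ 32) ^ 3 - j))
        ≤ 2 * (r ^ 32) ^ 2 * (7 / 6 / (r ^ 32) ^ 3) := by gcongr
      _ = 7 / 3 / r ^ 32 := by field_simp; norm_num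
      _ ≤ 4 / r ^ 32 := by gcongr; norm_num
  · gcongr
    · have h7 : (4 : ℝ) ≤ r ^ 7 :=
        calc (4 : ℝ) ≤ 2 ^ 7 := by norm_num
          _ ≤ r ^ 7 := by gcongr
      calc (i : ℝ) * ((r ^ 20)⁻¹ ^ 2 * (4 / r ^ 32))
          ≤ r ^ 65 * ((r ^ 20)⁻¹ ^ 2 * (4 / r ^ 32)) := by gcongr
        _ = 4 / r ^ 7 := by field_simp
        _ ≤ 1 := by rw [div_le_one (by positivity)]; exact h7
    · apply le_of_eq; field_simp

lemma card_StatIndex_le (hn : 1 ≤ n) : Fintype.card (StatIndex n) ≤ 30 * n ^ 2 := by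
  simp only [Fintype.card_sum, Fintype.card_prod, Fintype.card_fin]
  nlinarith

/-- With high probability all tracked statistics stay close to their compensated values. -/
lemma card_exists_statDeviation_le {r : ℝ} (hr : 2 ≤ r) (hn : (n : ℝ) = r ^ 32) {M : ℕ}
    (hM : (M : ℝ) ≤ r ^ 65) :
    ((Finset.univ.filter fun σ : Fin (n ^ 3) ≃ (Fin n × Fin n × Fin n) =>
        ¬ ∀ p, ∀ i ≤ M, statDeviation σ p i ≤ r ^ 24).card : ℝ) ≤
      Fintype.card (Fin (n ^ 3) ≃ (Fin n × Fin n × Fin n)) *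
        (120 * (n : ℝ) ^ 5 * Real.exp (1 - r ^ 4)) := by
  have hn1 : (1 : ℝ) ≤ n := by rw [hn]; exact one_le_pow₀ (by linarith)
  have hsub : (Finset.univ.filter fun σ : Fin (n ^ 3) ≃ (Fin n × Fin n × Fin n) =>
      ¬ ∀ p, ∀ i ≤ M, statDeviation σ p i ≤ r ^ 24) ⊆
      (Finset.univ ×ˢ Finset.range (M + 1) : Finset (StatIndex n × ℕ)).biUnion fun q =>
        Finset.univ.filter fun σ => r ^ 24 < statDeviation σ q.1 q.2 := by
    intro σ hσ
    simp only [Finset.mem_filter, Finset.mem_univ, true_and, not_forall, not_le] at hσ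
    obtain ⟨p, i, hi, h⟩ := hσ
    exact Finset.mem_biUnion.2 ⟨(p, i), by simp; omega, by simpa using h⟩
  have hcard : (((Finset.univ ×ˢ Finset.range (M + 1) : Finset (StatIndex n × ℕ)).card : ℕ) : ℝ) ≤
      30 * (n : ℝ) ^ 2 * (2 * (n : ℝ) ^ 3) := by
    rw [Finset.card_product, Finset.card_univ, Finset.card_range, Nat.cast_mul]
    have h1 : (Fintype.card (StatIndex n) : ℝ) ≤ 30 * (n : ℝ) ^ 2 := by
      exact_mod_cast card_StatIndex_le (by exact_mod_cast hn1)
    have h2 : ((M + 1 : ℕ) : ℝ) ≤ 2 * (n : ℝ) ^ 3 := by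
      have := le_cube_of_le (by linarith) hn hM
      have h4 : (M : ℝ) ≤ (n : ℝ) ^ 3 := by exact_mod_cast this
      push_cast
      linarith [one_le_pow₀ hn1 (n := 3)]
    gcongr
  calc _ ≤ ∑ q ∈ (Finset.univ ×ˢ Finset.range (M + 1) : Finset (StatIndex n × ℕ)),
        ((Finset.univ.filter fun σ : Fin (n ^ 3) ≃ (Fin n × Fin n × Fin n) =>
          r ^ 24 < statDeviation σ q.1 q.2).card : ℝ) := by
        exact_mod_cast (Finset.card_le_card hsub).trans Finset.card_biUnion_le
    _ ≤ _ := Finset.sum_le_card_nsmul _ _ _ fun q hq => by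
        refine card_statDeviation_le hr hn q.1 (le_trans ?_ hM)
        have := (Finset.mem_product.1 hq).2
        exact_mod_cast Nat.lt_succ_iff.1 (Finset.mem_range.1 this)
    _ ≤ 30 * (n : ℝ) ^ 2 * (2 * (n : ℝ) ^ 3) *
        (Fintype.card (Fin (n ^ 3) ≃ (Fin n × Fin n × Fin n)) * (2 * Real.exp (1 - r ^ 4))) := by
        rw [nsmul_eq_mul]; gcongr
    _ = _ := by ring

lemma one_sub_le_card_div_card {α : Type*} [Fintype α] [Nonempty α] {P Q : α → Prop}
    (hPQ : ∀ x, P x → Q x) {ε : ℝ}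
    (hP : ((Finset.univ.filter fun x => ¬ P x).card : ℝ) ≤ Fintype.card α * ε) :
    1 - ε ≤ ((Finset.univ.filter Q).card : ℝ) / Fintype.card α := by
  have hpos : (0 : ℝ) < Fintype.card α := by exact_mod_cast Fintype.card_pos
  rw [le_div_iff₀ hpos]
  have h1 : (Finset.univ.filter P).card ≤ (Finset.univ.filter Q).card :=
    Finset.card_le_card (Finset.monotone_filter_right _ fun x _ => hPQ x)
  have h2 := Finset.card_filter_add_card_filter_not (s := (Finset.univ : Finset α)) P
  rw [Finset.card_univ] at h2
  have h1' : ((Finset.univ.filter P).card : ℝ) ≤ (Finset.univ.filter Q).card := by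
    exact_mod_cast h1
  have h2' : ((Finset.univ.filter P).card : ℝ) + (Finset.univ.filter fun x => ¬ P x).card =
    Fintype.card α := by exact_mod_cast h2
  linarith

/-- The failure probability is eventually smaller than any inverse polynomial. -/
lemma eventually_failure_le (C : ℝ) :
    ∀ᶠ n : ℕ in Filter.atTop, 120 * (n : ℝ) ^ 5 *
      Real.exp (1 - ((n : ℝ) ^ (1 / 32 : ℝ)) ^ 4) ≤ (n : ℝ) ^ (-C) := by
  have hx : Filter.Tendsto (fun n : ℕ => (n : ℝ) ^ (1 / 8 : ℝ)) Filter.atTop Filter.atTop :=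
    (tendsto_rpow_atTop (by norm_num)).comp tendsto_natCast_atTop_atTop
  have h0 := (((tendsto_rpow_mul_exp_neg_mul_atTop_nhds_zero (8 * (5 + C)) 1 one_pos).comp
    hx).const_mul (120 * Real.exp 1))
  rw [mul_zero] at h0
  filter_upwards [h0.eventually_le_const one_pos, Filter.eventually_ge_atTop 1] with n hn hn1
  have hn0 : (0 : ℝ) < n := by exact_mod_cast hn1
  have h4 : ((n : ℝ) ^ (1 / 32 : ℝ)) ^ 4 = (n : ℝ) ^ (1 / 8 : ℝ) := by
    rw [← Real.rpow_natCast, ← Real.rpow_mul hn0.le]; norm_num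
  have h5 : ((n : ℝ) ^ (1 / 8 : ℝ)) ^ (8 * (5 + C)) = (n : ℝ) ^ 5 * (n : ℝ) ^ C := by
    rw [← Real.rpow_mul hn0.le, ← Real.rpow_natCast, ← Real.rpow_add hn0]
    congr 1; push_cast; ring
  simp only [Function.comp_apply, h5, neg_mul, one_mul] at hn
  rw [h4, Real.rpow_neg hn0.le, ← one_div, le_div_iff₀ (Real.rpow_pos_of_pos hn0 C),
    sub_eq_add_neg, Real.exp_add]
  calc _ = 120 * Real.exp 1 * ((n : ℝ) ^ 5 * (n : ℝ) ^ C *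
        Real.exp (-(n : ℝ) ^ (1 / 8 : ℝ))) := by ring
    _ ≤ 1 := hn

end Main

/-- In the random greedy triangle process over a uniformly random ordering of the `n³`
triangles, there exists `δ > 0` such that for every `η > 0` and `C > 0` and all large
`n`, with probability at least `1 − n^{−C}` every vertex `v` and every `m ≤ n^{2+δ}`
satisfy `d_{S_m}(v) = (1 − (1±η)/√(1+2m/n²))·n`. -/
theorem stmt15 :
    ∃ δ > (0 : ℝ), ∀ η > (0 : ℝ), ∀ C > (0 : ℝ), ∃ N : ℕ, ∀ n ≥ N,
      1 - (n : ℝ) ^ (-C) ≤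
      ((Finset.univ.filter (fun σ : Fin (n ^ 3) ≃ (Fin n × Fin n × Fin n) =>
          ∀ m : ℕ, (m : ℝ) ≤ (n : ℝ) ^ ((2 : ℝ) + δ) → ∀ v : Fin n,
            |(n : ℝ) - (((greedySet n σ m).filter (fun t => t.1 = v)).card : ℝ)
                - (n : ℝ) / Real.sqrt (1 + 2 * (m : ℝ) / (n : ℝ) ^ 2)|
              ≤ η * ((n : ℝ) / Real.sqrt (1 + 2 * (m : ℝ) / (n : ℝ) ^ 2)) ∧
            |(n : ℝ) - (((greedySet n σ m).filter (fun t => t.2.1 = v)).card : ℝ)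
                - (n : ℝ) / Real.sqrt (1 + 2 * (m : ℝ) / (n : ℝ) ^ 2)|
              ≤ η * ((n : ℝ) / Real.sqrt (1 + 2 * (m : ℝ) / (n : ℝ) ^ 2)) ∧
            |(n : ℝ) - (((greedySet n σ m).filter (fun t => t.2.2 = v)).card : ℝ)
                - (n : ℝ) / Real.sqrt (1 + 2 * (m : ℝ) / (n : ℝ) ^ 2)|
              ≤ η * ((n : ℝ) / Real.sqrt (1 + 2 * (m : ℝ) / (n : ℝ) ^ 2)))).card : ℝ)
        / (Fintype.card (Fin (n ^ 3) ≃ (Fin n × Fin n × Fin n)) : ℝ) := by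
  refine ⟨1 / 32, by norm_num, fun η hη C _ => ?_⟩
  have hr : Filter.Tendsto (fun n : ℕ => (n : ℝ) ^ (1 / 32 : ℝ)) Filter.atTop Filter.atTop :=
    (tendsto_rpow_atTop (by norm_num)).comp tendsto_natCast_atTop_atTop
  obtain ⟨N, hN⟩ := Filter.eventually_atTop.1 ((eventually_failure_le C).and
    ((hr.eventually_ge_atTop 243).and (hr.eventually_ge_atTop (2214 / η))))
  refine ⟨N, fun n hn => ?_⟩
  obtain ⟨hfail, hr243, hrη⟩ := hN n hn
  set r : ℝ := (n : ℝ) ^ (1 / 32 : ℝ) with hrdef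
  have hnr : (n : ℝ) = r ^ 32 := by
    rw [hrdef, ← Real.rpow_natCast, ← Real.rpow_mul n.cast_nonneg]; norm_num
  have h65 : (n : ℝ) ^ ((2 : ℝ) + 1 / 32) = r ^ 65 := by
    rw [hrdef, ← Real.rpow_natCast, ← Real.rpow_mul n.cast_nonneg]; norm_num
  have hη' : 2214 ≤ η * r := by rwa [div_le_iff₀' hη] at hrη
  have hM : (⌊r ^ 65⌋₊ : ℝ) ≤ r ^ 65 := Nat.floor_le (by positivity)
  have : Nonempty (Fin (n ^ 3) ≃ (Fin n × Fin n × Fin n)) :=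
    ⟨Fintype.equivOfCardEq (by simp; ring)⟩
  have hbad := card_exists_statDeviation_le (by linarith) hnr hM
  refine (sub_le_sub_left hfail 1).trans (one_sub_le_card_div_card
    (P := fun σ => ∀ p, ∀ i ≤ ⌊r ^ 65⌋₊, statDeviation σ p i ≤ r ^ 24)
    (fun σ hσ m hm v => ?_) (by convert hbad))
  rw [h65] at hm
  have key := fun k => degree_concentration hr243 hη' hnr hM hσ k v (Nat.le_floor hm)
  exact ⟨key 0, key 1, key 2⟩

end
end
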